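/- arXiv:0909.1462 — 2 statements merged into one kernel-verified Lean document; each statement's English description precedes it below -/
import Mathlib

section
/- Let f be a polynomial in one variable with complex coefficients. If the integral over the unit interval [0,1] of the m-th power of f vanishes for every integer m ≥ 1 (that is, ∫₀¹ f(x)^m dx = 0 for all m ≥ 1), then f is the zero polynomial. -/
open MeasureTheory intervalIntegral

/-- The key arithmetic step over an algebraic extension of `ℚ`. -/
lemma moments_number_field {K : Type*} [Field K] [Algebra ℚ K] [Algebra.IsAlgebraic ℚ K]
    (g : Polynomial K) (hd : g.natDegree ≠ 0)
    (h : ∀ m : ℕ, 1 ≤ m → ∑ k ∈ Finset.range (g.natDegree * m + 1),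
      ((k + 1 : ℚ)⁻¹) • (g ^ m).coeff k = 0) : False := by
  classical
  have : CharZero K := algebraRat.charZero K
  have : Algebra.IsAlgebraic ℤ K := (IsFractionRing.comap_isAlgebraic_iff (A := ℤ) (K := ℚ) (C := K)).2 inferInstance
  set d := g.natDegree with hdd
  have hg0 : g ≠ 0 := by rintro rfl; simp [hdd] at hd
  have hlc : g.leadingCoeff ≠ 0 := by simpa using hg0
  obtain ⟨N, hN0, hN⟩ := Algebra.IsAlgebraic.exists_integral_multiples ℤ (A := K)
    (insert (g.leadingCoeff⁻¹) g.coeffs)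
  have hcoef : ∀ k, IsIntegral ℤ ((N : K) * g.coeff k) := by
    intro k
    by_cases hk : g.coeff k = 0
    · rw [hk, mul_zero]; exact isIntegral_zero
    · have := hN (g.coeff k) (Finset.mem_insert_of_mem (Polynomial.coeff_mem_coeffs hk))
      simpa [zsmul_eq_mul] using this
  have hinv : IsIntegral ℤ ((N : K) * g.leadingCoeff⁻¹) := by
    simpa [zsmul_eq_mul] using hN _ (Finset.mem_insert_self _ _)
  obtain ⟨p, hp, hpN, hmod⟩ := Nat.exists_prime_gt_modEq_one (N.natAbs) hd
  obtain ⟨m, hm⟩ : d ∣ p - 1 := (Nat.modEq_iff_dvd' hp.one_le).1 hmod.symm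
  have hm1 : 1 ≤ m := by
    rcases Nat.eq_zero_or_pos m with rfl | h
    · have := hp.two_le; omega
    · exact h
  have hp1 : p = d * m + 1 := by have := hp.two_le; omega
  -- integrality of the coefficients of powers
  have hpow : ∀ (j k : ℕ), IsIntegral ℤ ((N : K) ^ j * (g ^ j).coeff k) := by
    intro j
    induction j with
    | zero =>
      intro k
      rw [pow_zero, pow_zero, one_mul, Polynomial.coeff_one]
      split_ifs
      · exact isIntegral_one
      · exact isIntegral_zero
    | succ j ih =>
      intro k
      rw [pow_succ g, Polynomial.coeff_mul, Finset.mul_sum]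
      refine IsIntegral.sum _ fun x _ => ?_
      have := (ih x.1).mul (hcoef x.2)
      convert this using 1
      ring
  have hrel := h m hm1
  rw [Finset.sum_range_succ] at hrel
  have htop : (g ^ m).coeff (d * m) = g.leadingCoeff ^ m := by
    rw [mul_comm, hdd, Polynomial.coeff_pow_mul_natDegree]
  rw [htop] at hrel
  -- the rational number in question
  set q : ℚ := (((p - 1).factorial * N ^ m * N ^ m : ℤ) : ℚ) / p with hq
  have hpK : (p : K) ≠ 0 := by exact_mod_cast hp.ne_zero
  have hint : IsIntegral ℤ (algebraMap ℚ K q) := by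
    have key : algebraMap ℚ K q = -(((N : K) * g.leadingCoeff⁻¹) ^ m *
        ∑ k ∈ Finset.range (d * m), (((p - 1).factorial / (k + 1) : ℕ) : K) *
          ((N : K) ^ m * (g ^ m).coeff k)) := by
      have e1 : ∑ k ∈ Finset.range (d * m), (((p - 1).factorial / (k + 1) : ℕ) : K) *
          ((N : K) ^ m * (g ^ m).coeff k) = ((p - 1).factorial : K) * (N : K) ^ m *
          ∑ k ∈ Finset.range (d * m), ((k + 1 : ℚ)⁻¹) • (g ^ m).coeff k := by
        rw [Finset.mul_sum]
        refine Finset.sum_congr rfl fun k hk => ?_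
        have hk' : k + 1 ∣ (p - 1).factorial :=
          Nat.dvd_factorial (Nat.succ_pos _) (by have := Finset.mem_range.1 hk; omega)
        have hk0 : ((k : K) + 1) ≠ 0 := by exact_mod_cast Nat.succ_ne_zero k
        rw [Nat.cast_div hk' (by exact_mod_cast hk0), Algebra.smul_def]
        simp only [map_inv₀, map_add, map_natCast, map_one, Nat.cast_add, Nat.cast_one]
        field_simp
      rw [e1, eq_neg_of_add_eq_zero_left hrel, Algebra.smul_def, hq]
      have hpc : (algebraMap ℚ K) (((d * m : ℕ) : ℚ) + 1)⁻¹ = (p : K)⁻¹ := by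
        rw [hp1]; simp
      rw [hpc]
      simp only [map_div₀, map_intCast, map_natCast]
      push_cast
      rw [mul_pow, inv_pow]
      field_simp
    rw [key]
    refine IsIntegral.neg ((hinv.pow m).mul (IsIntegral.sum _ fun k _ => ?_))
    refine IsIntegral.mul ?_ (hpow m k)
    exact_mod_cast isIntegral_algebraMap (R := ℤ) (A := K) (x := (((p - 1).factorial / (k + 1) : ℕ) : ℤ))
  have hintq : IsIntegral ℤ q :=
    (isIntegral_algebraMap_iff (algebraMap ℚ K).injective).1 hint
  obtain ⟨z, hz⟩ := IsIntegrallyClosed.isIntegral_iff.1 hintq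
  have hpq : (p : ℚ) ≠ 0 := by exact_mod_cast hp.ne_zero
  have hz' : ((p - 1).factorial * N ^ m * N ^ m : ℤ) = p * z := by
    have : (z : ℚ) = q := by simpa using hz
    rw [hq, eq_div_iff hpq] at this
    have h2 : (((p - 1).factorial * N ^ m * N ^ m : ℤ) : ℚ) = ((p * z : ℤ) : ℚ) := by
      rw [← this]; push_cast; ring
    exact_mod_cast h2
  have hpZ : Prime (p : ℤ) := Nat.prime_iff_prime_int.1 hp
  have hNp : ¬ (p : ℤ) ∣ N := fun hdvd => by
    have := Nat.le_of_dvd (Int.natAbs_pos.2 hN0) (Int.natCast_dvd.1 hdvd)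
    omega
  have hdvd : (p : ℤ) ∣ (p - 1).factorial * N ^ m * N ^ m := ⟨z, hz'⟩
  rcases hpZ.dvd_or_dvd hdvd with h1 | h1
  · rcases hpZ.dvd_or_dvd h1 with h2 | h2
    · have := (hp.dvd_factorial).1 (Int.natCast_dvd_natCast.1 h2)
      have := hp.two_le
      omega
    · exact hNp (hpZ.dvd_of_dvd_pow h2)
  · exact hNp (hpZ.dvd_of_dvd_pow h1)

/-- Specialization from `ℂ` to a number field. -/
lemma moments_complex (f : Polynomial ℂ) (hd : f.natDegree ≠ 0)
    (h : ∀ m : ℕ, 1 ≤ m → ∑ k ∈ Finset.range (f.natDegree * m + 1),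
      ((k + 1 : ℚ)⁻¹) • (f ^ m).coeff k = 0) : False := by
  classical
  have hf0 : f ≠ 0 := by rintro rfl; simp at hd
  have hlc : f.leadingCoeff ≠ 0 := by simpa using hf0
  set S : Finset ℂ := insert (f.leadingCoeff⁻¹) f.coeffs with hS
  set B : Subalgebra ℚ ℂ := Algebra.adjoin ℚ (S : Set ℂ) with hB
  have : Algebra.FiniteType ℚ B :=
    (Subalgebra.fg_iff_finiteType B).1 ⟨S, rfl⟩
  have hinj : Function.Injective (algebraMap B ℂ) := Subtype.val_injective
  obtain ⟨F, hF⟩ : ∃ F : Polynomial B, F.map (algebraMap B ℂ) = f := by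
    have : f ∈ Polynomial.lifts (algebraMap B ℂ) := by
      rw [Polynomial.lifts_iff_coeff_lifts]
      intro k
      have hk : f.coeff k ∈ B := by
        by_cases hk : f.coeff k = 0
        · rw [hk]; exact B.zero_mem
        · exact Algebra.subset_adjoin
            (by simpa [hS] using Or.inr (Polynomial.coeff_mem_coeffs hk))
      exact ⟨⟨_, hk⟩, rfl⟩
    exact (Polynomial.mem_lifts _).1 this
  have hdeg : F.natDegree = f.natDegree := by
    rw [← hF, Polynomial.natDegree_map_eq_of_injective hinj]
  have hlcF : algebraMap B ℂ F.leadingCoeff = f.leadingCoeff := by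
    rw [← hF, Polynomial.leadingCoeff_map_of_injective hinj]
  have hinvmem : f.leadingCoeff⁻¹ ∈ B :=
    Algebra.subset_adjoin (by simp [hS])
  have hunit : IsUnit F.leadingCoeff := by
    refine IsUnit.of_mul_eq_one ⟨_, hinvmem⟩ (hinj ?_)
    rw [map_mul, hlcF, map_one]
    exact mul_inv_cancel₀ hlc
  have hFrel : ∀ m : ℕ, 1 ≤ m → ∑ k ∈ Finset.range (F.natDegree * m + 1),
      ((k + 1 : ℚ)⁻¹) • (F ^ m).coeff k = 0 := by
    intro m hm
    refine hinj ?_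
    rw [map_zero, ← h m hm, map_sum, hdeg]
    refine Finset.sum_congr rfl fun k _ => ?_
    rw [← hF, ← Polynomial.map_pow, Polynomial.coeff_map]
    rfl
  obtain ⟨M, hM⟩ := Ideal.exists_maximal B
  let : Field (B ⧸ M) := Ideal.Quotient.field M
  have : Algebra.FiniteType ℚ (B ⧸ M) :=
    Algebra.FiniteType.of_surjective (Ideal.Quotient.mkₐ ℚ M) (Ideal.Quotient.mkₐ_surjective ℚ M)
  have : Module.Finite ℚ (B ⧸ M) := finite_of_finite_type_of_isJacobsonRing ℚ (B ⧸ M)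
  have : Algebra.IsAlgebraic ℚ (B ⧸ M) := Algebra.IsAlgebraic.of_finite ℚ (B ⧸ M)
  let φ : B →ₐ[ℚ] (B ⧸ M) := Ideal.Quotient.mkₐ ℚ M
  have hdeg2 : (F.map (φ : B →+* B ⧸ M)).natDegree = F.natDegree :=
    Polynomial.natDegree_map_of_leadingCoeff_ne_zero _
      (hunit.map (φ : B →+* B ⧸ M)).ne_zero
  refine moments_number_field (F.map (φ : B →+* B ⧸ M)) (by rw [hdeg2, hdeg]; exact hd) ?_
  intro m hm
  have := congrArg φ (hFrel m hm)
  rw [map_zero, map_sum] at this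
  rw [hdeg2, ← this]
  refine Finset.sum_congr rfl fun k _ => ?_
  rw [← Polynomial.map_pow, Polynomial.coeff_map, map_smul]
  rfl

/-- The integral of a polynomial over the unit interval. -/
lemma integral_poly (g : Polynomial ℂ) (n : ℕ) (hn : g.natDegree < n) :
    ∫ x in (0:ℝ)..1, g.eval (x : ℂ) =
      ∑ k ∈ Finset.range n, ((k + 1 : ℚ)⁻¹) • g.coeff k := by
  simp_rw [Polynomial.eval_eq_sum_range' hn]
  rw [intervalIntegral.integral_finsetSum]
  · refine Finset.sum_congr rfl fun k _ => ?_
    rw [intervalIntegral.integral_const_mul]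
    have : ∫ x in (0:ℝ)..1, (x : ℂ) ^ k = ((k : ℂ) + 1)⁻¹ := by
      have h1 : ∀ x : ℝ, (x : ℂ) ^ k = ((x ^ k : ℝ) : ℂ) := fun x => by push_cast; rfl
      simp_rw [h1]
      rw [intervalIntegral.integral_ofReal, integral_pow]
      simp
    rw [this, Algebra.smul_def, mul_comm]
    simp
  · intro k _
    exact (Continuous.intervalIntegrable (by fun_prop) _ _)

/-- One-variable case of the vanishing-moments problem: if all moments
`∫₀¹ f(x)^m dx` (for `m ≥ 1`) of a univariate complex polynomial `f`
vanish, then `f = 0`. -/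
theorem polynomial_eq_zero_of_vanishing_powers_integral
    (f : Polynomial ℂ)
    (h : ∀ m : ℕ, 1 ≤ m → ∫ x in (0:ℝ)..1, (f.eval (x : ℂ)) ^ m = 0) :
    f = 0 := by
  by_cases hd : f.natDegree = 0
  · obtain ⟨c, rfl⟩ := Polynomial.natDegree_eq_zero.1 hd
    have := h 1 le_rfl
    simpa using this
  · exfalso
    refine moments_complex f hd fun m hm => ?_
    rw [← integral_poly (f ^ m) _ (by
      rw [Polynomial.natDegree_pow, mul_comm]; exact Nat.lt_succ_self _), ← h m hm]
    simp
end

section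
/- Let k be a field. Every k-algebra automorphism of the polynomial ring k[x,y] in two variables is tame: it lies in the subgroup of the automorphism group of k[x,y] generated by the affine automorphisms (those sending each variable to a polynomial of total degree at most 1) together with the triangular automorphisms (those sending x to c·x + f(y) and y to d·y + e, with c, d ∈ k nonzero, e ∈ k, and f ∈ k[y]). (Jung–van der Kulk theorem, stated in the paper.) -/
open MvPolynomial

/-- An automorphism of `k[x,y]` is affine if it sends each variable to a
polynomial of total degree at most 1. -/
def IsAffineAut {k : Type*} [Field k]
    (φ : MvPolynomial (Fin 2) k ≃ₐ[k] MvPolynomial (Fin 2) k) : Prop :=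
  ∀ i : Fin 2, (φ (X i)).totalDegree ≤ 1

/-- An automorphism of `k[x,y]` is triangular if it sends
`x ↦ c·x + f(y)` and `y ↦ d·y + e` with `c, d ∈ k` nonzero, `e ∈ k`,
`f ∈ k[y]`. -/
def IsTriangularAut {k : Type*} [Field k]
    (φ : MvPolynomial (Fin 2) k ≃ₐ[k] MvPolynomial (Fin 2) k) : Prop :=
  ∃ (c d e : k) (f : Polynomial k), c ≠ 0 ∧ d ≠ 0 ∧
    φ (X 0) = C c * X 0 + Polynomial.aeval (X 1 : MvPolynomial (Fin 2) k) f ∧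
    φ (X 1) = C d * X 1 + C e


section partA
open Polynomial

theorem jvk_sep {R : Type*} [CommRing R] [IsDomain R] (r s : ℕ) (hr : 2 ≤ r) (hs : 2 ≤ s)
    (hr0 : (r : R) ≠ 0) (hs0 : (s : R) ≠ 0) (g κ : R) (hg : g ≠ 0) (hκ : κ ≠ 0) :
    ∀ (n : ℕ) (P Q : R[X]), P.natDegree + Q.natDegree ≤ n →
      P ^ r - Polynomial.C g * Q ^ s = Polynomial.C κ → P.natDegree = 0 ∧ Q.natDegree = 0 := by
  intro n
  induction n using Nat.strong_induction_on with
  | _ n ih =>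
  intro P Q hn h
  have hd := congrArg derivative h
  simp only [derivative_sub, derivative_pow, derivative_mul, derivative_C, zero_mul, zero_add] at hd
  obtain ⟨r, rfl⟩ : ∃ r', r = r' + 1 := ⟨r - 1, by omega⟩
  obtain ⟨s, rfl⟩ : ∃ s', s = s' + 1 := ⟨s - 1, by omega⟩
  simp only [Nat.add_sub_cancel] at hd
  have hr1 : Polynomial.C (((r + 1 : ℕ) : R)) ≠ 0 := by rw [Ne, Polynomial.C_eq_zero]; exact hr0
  have hs1 : Polynomial.C (((s + 1 : ℕ) : R)) ≠ 0 := by rw [Ne, Polynomial.C_eq_zero]; exact hs0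
  have hg1 : Polynomial.C g ≠ 0 := by simpa using hg
  have hκ1 : Polynomial.C κ ≠ 0 := by simpa using hκ
  have key1 : Polynomial.C (((r + 1 : ℕ) : R)) * Polynomial.C κ * derivative P =
      Q ^ s * (Polynomial.C g * (Polynomial.C (((s + 1 : ℕ) : R)) * P * derivative Q
        - Polynomial.C (((r + 1 : ℕ) : R)) * Q * derivative P)) := by
    rw [← h]; linear_combination P * hd
  have key2 : Polynomial.C (((s + 1 : ℕ) : R)) * Polynomial.C κ * derivative Q =
      P ^ r * ((Polynomial.C (((s + 1 : ℕ) : R)) * P * derivative Q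
        - Polynomial.C (((r + 1 : ℕ) : R)) * Q * derivative P)) := by
    rw [← h]; linear_combination Q * hd
  by_cases hP : derivative P = 0
  · by_cases hQ : derivative Q = 0
    · obtain ⟨p, hp⟩ := CharP.exists R
      rcases CharP.char_is_prime_or_zero R p with hpp | hp0
      · have e1 := expand_contract p hP hpp.ne_zero
        have e2 := expand_contract p hQ hpp.ne_zero
        have d1 := natDegree_expand p (contract p P)
        have d2 := natDegree_expand p (contract p Q)
        rw [e1] at d1
        rw [e2] at d2
        by_cases hz : P.natDegree + Q.natDegree = 0
        · omega
        have hp2 := hpp.two_le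
        have := ih ((contract p P).natDegree + (contract p Q).natDegree) (by nlinarith [Nat.pos_of_ne_zero hz])
          (contract p P) (contract p Q) le_rfl (by
            apply Polynomial.expand_injective hpp.pos
            simp only [map_sub, map_mul, map_pow, e1, e2, Polynomial.expand_C, h])
        rw [d1, d2, this.1, this.2]; simp
      · subst hp0
        have : CharZero R := CharP.charP_to_charZero R
        exact ⟨derivative_eq_zero.mp hP, derivative_eq_zero.mp hQ⟩
    · exfalso
      rw [hP] at hd
      have hQ0 : Q ≠ 0 := by rintro rfl; simp at hQ
      have : Polynomial.C g * (Polynomial.C (((s + 1 : ℕ) : R)) * Q ^ s * derivative Q) = 0 := by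
        linear_combination -hd
      simp_all
  · by_cases hQ : derivative Q = 0
    · exfalso
      rw [hQ] at hd
      have hP0 : P ≠ 0 := by rintro rfl; simp at hP
      have : (Polynomial.C (((r + 1 : ℕ) : R)) * P ^ r * derivative P) = 0 := by
        linear_combination hd
      simp_all
    · exfalso
      have n1 : P.natDegree ≠ 0 := fun h0 => hP (by
        rw [natDegree_eq_zero.mp h0 |>.choose_spec.symm]; simp)
      have n2 : Q.natDegree ≠ 0 := fun h0 => hQ (by
        rw [natDegree_eq_zero.mp h0 |>.choose_spec.symm]; simp)
      have l1 := natDegree_derivative_lt n1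
      have l2 := natDegree_derivative_lt n2
      have a1 := natDegree_le_of_dvd (Dvd.intro _ key1.symm) (mul_ne_zero (mul_ne_zero hr1 hκ1) hP)
      have a2 := natDegree_le_of_dvd (Dvd.intro _ key2.symm) (mul_ne_zero (mul_ne_zero hs1 hκ1) hQ)
      rw [mul_assoc, natDegree_C_mul hr0, natDegree_C_mul hκ, natDegree_pow] at a1
      rw [mul_assoc, natDegree_C_mul hs0, natDegree_C_mul hκ, natDegree_pow] at a2
      have : Q.natDegree ≤ s * Q.natDegree := Nat.le_mul_of_pos_left _ (by omega)
      have : P.natDegree ≤ r * P.natDegree := Nat.le_mul_of_pos_left _ (by omega)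
      omega

/-- inseparable case, via a derivation of the coefficients -/
theorem jvk_insep {k R : Type*} [Field k] [CommRing R] [IsDomain R] [Algebra k R]
    (D : Derivation k R[X] R[X]) (r s : ℕ) (hs : 2 ≤ s) (g : k) (hg : g ≠ 0) (x y : R) (hy : y ≠ 0)
    (hDy : D (Polynomial.C y) = 1) (hr0 : (r : k) = 0) (hs0 : (s : k) ≠ 0) (P Q : R[X])
    (h : P ^ r - algebraMap k R[X] g * Q ^ s =
      Polynomial.C x ^ r - algebraMap k R[X] g * Polynomial.C y ^ s) :
    Q.natDegree = 0 := by
  have hd := congrArg D h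
  have hrR : (r : R[X]) = 0 := by
    have := congrArg (algebraMap k R[X]) hr0
    simpa using this
  have hsR : (s : R[X]) ≠ 0 := by
    intro h0
    apply hs0
    apply (algebraMap k R[X]).injective
    simpa using h0
  have hgR : algebraMap k R[X] g ≠ 0 := by simpa using hg
  simp only [map_sub, Derivation.leibniz, Derivation.leibniz_pow, smul_eq_mul, nsmul_eq_mul,
    Derivation.map_algebraMap, hrR, hDy, mul_zero, zero_mul, add_zero, zero_sub, mul_one] at hd
  have h2 : (s : R[X]) * algebraMap k R[X] g * (Q ^ (s - 1) * D Q) = (s : R[X]) * algebraMap k R[X] g * Polynomial.C y ^ (s - 1) := by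
    linear_combination -hd
  have h3 := mul_left_cancel₀ (mul_ne_zero hsR hgR) h2
  have hne : Polynomial.C y ^ (s - 1) ≠ 0 := pow_ne_zero _ (by simpa using hy)
  have h4 := natDegree_le_of_dvd (Dvd.intro _ h3) hne
  rw [natDegree_pow, ← Polynomial.C_pow, natDegree_C] at h4
  have : 0 < s - 1 := by omega
  by_contra hQ
  have : 0 < (s-1) * Q.natDegree := Nat.mul_pos this (Nat.pos_of_ne_zero hQ)
  omega


/-- coefficientwise partial derivative -/
noncomputable def jvkD (k : Type*) [Field k] (i : Fin 2) :
    Derivation k (MvPolynomial (Fin 2) k)[X] (MvPolynomial (Fin 2) k)[X] :=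
  Derivation.mk' ((finSuccEquiv k 2).toLinearMap ∘ₗ (pderiv (i.succ) : Derivation k _ _).toLinearMap ∘ₗ
    (finSuccEquiv k 2).symm.toLinearMap) (by
      intro a b
      simp [Derivation.leibniz])

theorem jvkD_C (k : Type*) [Field k] (i : Fin 2) :
    jvkD k i (Polynomial.C (MvPolynomial.X i)) = 1 := by
  rw [← finSuccEquiv_X_succ]
  change finSuccEquiv k 2 (pderiv i.succ ((finSuccEquiv k 2).symm _)) = 1
  simp

theorem jvk_binom {k : Type*} [Field k] (P : Fin 2 → (MvPolynomial (Fin 2) k)[X]) (r s : ℕ)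
    (hr : 2 ≤ r) (hs : 2 ≤ s) (hc : Nat.Coprime r s) (g : k) (hg : g ≠ 0)
    (h : P 0 ^ r - algebraMap k _ g * P 1 ^ s =
      Polynomial.C (MvPolynomial.X 0) ^ r - algebraMap k _ g * Polynomial.C (MvPolynomial.X 1) ^ s) :
    (P 0).natDegree = 0 ∧ (P 1).natDegree = 0 := by
  have hgg : algebraMap k (MvPolynomial (Fin 2) k)[X] g⁻¹ * algebraMap k (MvPolynomial (Fin 2) k)[X] g = 1 := by
    rw [← map_mul, inv_mul_cancel₀ hg, map_one]
  have halg : algebraMap k (MvPolynomial (Fin 2) k)[X] g = Polynomial.C (MvPolynomial.C g) := rfl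
  by_cases hr0 : (r : k) = 0
  · have hs0 : (s : k) ≠ 0 := by
      intro hs0
      obtain ⟨p, hp⟩ := CharP.exists k
      have h1 := (CharP.cast_eq_zero_iff k p r).mp hr0
      have h2 := (CharP.cast_eq_zero_iff k p s).mp hs0
      have := Nat.dvd_gcd h1 h2
      rw [hc] at this
      have h3 : p = 1 := Nat.dvd_one.mp this
      exact CharP.char_ne_one k p h3
    have h1 := jvk_insep (jvkD k 1) r s hs g hg _ _ (MvPolynomial.X_ne_zero _) (jvkD_C k 1) hr0 hs0 _ _ h
    refine ⟨?_, h1⟩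
    obtain ⟨q, hq⟩ := natDegree_eq_zero.mp h1
    have h2 : P 0 ^ r = Polynomial.C (MvPolynomial.X 0 ^ r - MvPolynomial.C g * MvPolynomial.X 1 ^ s + MvPolynomial.C g * q ^ s) := by
      rw [← hq, halg] at h
      simp only [map_add, map_sub, map_mul, map_pow]
      linear_combination h
    have h3 := congrArg natDegree h2
    rw [natDegree_pow, natDegree_C] at h3
    rcases Nat.mul_eq_zero.mp h3 with h3 | h3
    · omega
    · exact h3
  · by_cases hs0 : (s : k) = 0
    · have h' : P 1 ^ s - algebraMap k _ g⁻¹ * P 0 ^ r =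
        Polynomial.C (MvPolynomial.X 1) ^ s - algebraMap k _ g⁻¹ * Polynomial.C (MvPolynomial.X 0) ^ r := by
        linear_combination (-algebraMap k (MvPolynomial (Fin 2) k)[X] g⁻¹) * h - (P 1 ^ s -  Polynomial.C (MvPolynomial.X 1) ^ s) * hgg
      have h1 := jvk_insep (jvkD k 0) s r hr g⁻¹ (inv_ne_zero hg) _ _ (MvPolynomial.X_ne_zero _) (jvkD_C k 0) hs0 hr0 _ _ h'
      refine ⟨h1, ?_⟩
      obtain ⟨q, hq⟩ := natDegree_eq_zero.mp h1
      have h2 : P 1 ^ s = Polynomial.C (MvPolynomial.X 1 ^ s - MvPolynomial.C g⁻¹ * MvPolynomial.X 0 ^ r + MvPolynomial.C g⁻¹ * q ^ r) := by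
        have halg : algebraMap k (MvPolynomial (Fin 2) k)[X] g⁻¹ = Polynomial.C (MvPolynomial.C g⁻¹) := rfl
        rw [← hq, halg] at h'
        simp only [map_add, map_sub, map_mul, map_pow]
        linear_combination h'
      have h3 := congrArg natDegree h2
      rw [natDegree_pow, natDegree_C] at h3
      rcases Nat.mul_eq_zero.mp h3 with h3 | h3
      · omega
      · exact h3
    · have cne : ∀ n : ℕ, (n : k) ≠ 0 → (n : MvPolynomial (Fin 2) k) ≠ 0 := by
        intro n hn h0
        apply hn
        apply MvPolynomial.C_injective (Fin 2) k
        simpa using h0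
      refine jvk_sep r s hr hs (cne r hr0) (cne s hs0) (MvPolynomial.C g)
        (MvPolynomial.X 0 ^ r - MvPolynomial.C g * MvPolynomial.X 1 ^ s) (by simpa using hg) ?_ _ _ _ le_rfl ?_
      · intro h0
        have := congrArg (MvPolynomial.eval (fun i : Fin 2 => if i = 0 then (1:k) else 0)) h0
        have hs' : s ≠ 0 := by omega
        simp [hs'] at this
      · rw [halg] at h
        simp only [map_sub, map_mul, map_pow]
        exact h

end partA

section partB
variable {k : Type*} [Field k] {σ τ : Type*}

/-- All monomials have weight at most `a`. -/
def JLe (ω : σ → ℚ) (a : ℚ) (f : MvPolynomial σ k) : Prop :=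
  ∀ d, coeff d f ≠ 0 → Finsupp.weight ω d ≤ a
/-- All monomials have weight less than `a`. -/
def JLt (ω : σ → ℚ) (a : ℚ) (f : MvPolynomial σ k) : Prop :=
  ∀ d, coeff d f ≠ 0 → Finsupp.weight ω d < a
/-- All monomials have weight equal to `a`. -/
def JEq (ω : σ → ℚ) (a : ℚ) (f : MvPolynomial σ k) : Prop :=
  ∀ d, coeff d f ≠ 0 → Finsupp.weight ω d = a
/-- `g` is the weight `a` part of `f`, which has no monomials of weight larger than `a`. -/
def JLead (ω : σ → ℚ) (a : ℚ) (f g : MvPolynomial σ k) : Prop :=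
  JEq ω a g ∧ JLt ω a (f - g)

lemma JLt.le {ω : σ → ℚ} {a : ℚ} {f : MvPolynomial σ k} (h : JLt ω a f) : JLe ω a f :=
  fun d hd => (h d hd).le
lemma JEq.le {ω : σ → ℚ} {a : ℚ} {f : MvPolynomial σ k} (h : JEq ω a f) : JLe ω a f :=
  fun d hd => (h d hd).le
lemma jadd_aux {f g : MvPolynomial σ k} {d : σ →₀ ℕ} (h : coeff d (f + g) ≠ 0) :
    coeff d f ≠ 0 ∨ coeff d g ≠ 0 := by
  by_contra! hh
  simp [hh.1, hh.2] at h
lemma JLt.add {ω : σ → ℚ} {a : ℚ} {f g : MvPolynomial σ k} (h : JLt ω a f) (h' : JLt ω a g) :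
    JLt ω a (f + g) := fun d hd => (jadd_aux hd).elim (h d) (h' d)
lemma JLe.add {ω : σ → ℚ} {a : ℚ} {f g : MvPolynomial σ k} (h : JLe ω a f) (h' : JLe ω a g) :
    JLe ω a (f + g) := fun d hd => (jadd_aux hd).elim (h d) (h' d)
lemma JEq.add {ω : σ → ℚ} {a : ℚ} {f g : MvPolynomial σ k} (h : JEq ω a f) (h' : JEq ω a g) :
    JEq ω a (f + g) := fun d hd => (jadd_aux hd).elim (h d) (h' d)
lemma JLt.sum {ω : σ → ℚ} {a : ℚ} {ι : Type*} (s : Finset ι) (f : ι → MvPolynomial σ k)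
    (h : ∀ i ∈ s, JLt ω a (f i)) : JLt ω a (∑ i ∈ s, f i) := by
  intro d hd
  rw [coeff_sum] at hd
  obtain ⟨i, hi, hi'⟩ := Finset.exists_ne_zero_of_sum_ne_zero hd
  exact h i hi d hi'
lemma JEq.sum {ω : σ → ℚ} {a : ℚ} {ι : Type*} (s : Finset ι) (f : ι → MvPolynomial σ k)
    (h : ∀ i ∈ s, JEq ω a (f i)) : JEq ω a (∑ i ∈ s, f i) := by
  intro d hd
  rw [coeff_sum] at hd
  obtain ⟨i, hi, hi'⟩ := Finset.exists_ne_zero_of_sum_ne_zero hd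
  exact h i hi d hi'
lemma jmul_aux {f g : MvPolynomial σ k} {d : σ →₀ ℕ} (h : coeff d (f * g) ≠ 0) :
    ∃ p q, p + q = d ∧ coeff p f ≠ 0 ∧ coeff q g ≠ 0 := by
  classical
  rw [coeff_mul] at h
  obtain ⟨⟨p, q⟩, hi, hi'⟩ := Finset.exists_ne_zero_of_sum_ne_zero h
  exact ⟨p, q, by simpa using hi, left_ne_zero_of_mul hi', right_ne_zero_of_mul hi'⟩
lemma JLe.mul {ω : σ → ℚ} {a b : ℚ} {f g : MvPolynomial σ k} (h : JLe ω a f) (h' : JLe ω b g) :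
    JLe ω (a + b) (f * g) := by
  intro d hd
  obtain ⟨p, q, rfl, hp, hq⟩ := jmul_aux hd
  rw [map_add]; exact add_le_add (h p hp) (h' q hq)
lemma JEq.mul {ω : σ → ℚ} {a b : ℚ} {f g : MvPolynomial σ k} (h : JEq ω a f) (h' : JEq ω b g) :
    JEq ω (a + b) (f * g) := by
  intro d hd
  obtain ⟨p, q, rfl, hp, hq⟩ := jmul_aux hd
  rw [map_add, h p hp, h' q hq]
lemma JLt.mul_le {ω : σ → ℚ} {a b : ℚ} {f g : MvPolynomial σ k} (h : JLt ω a f) (h' : JLe ω b g) :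
    JLt ω (a + b) (f * g) := by
  intro d hd
  obtain ⟨p, q, rfl, hp, hq⟩ := jmul_aux hd
  rw [map_add]; exact add_lt_add_of_lt_of_le (h p hp) (h' q hq)
lemma JLe.mul_lt {ω : σ → ℚ} {a b : ℚ} {f g : MvPolynomial σ k} (h : JLe ω a f) (h' : JLt ω b g) :
    JLt ω (a + b) (f * g) := by
  intro d hd
  obtain ⟨p, q, rfl, hp, hq⟩ := jmul_aux hd
  rw [map_add]; exact add_lt_add_of_le_of_lt (h p hp) (h' q hq)
lemma JLead.le {ω : σ → ℚ} {a : ℚ} {f g : MvPolynomial σ k} (h : JLead ω a f g) : JLe ω a f := by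
  have := h.1.le.add h.2.le
  simpa using this
lemma JLead.mul {ω : σ → ℚ} {a b : ℚ} {f g f' g' : MvPolynomial σ k} (h : JLead ω a f g)
    (h' : JLead ω b f' g') : JLead ω (a + b) (f * f') (g * g') := by
  refine ⟨h.1.mul h'.1, ?_⟩
  have := (h.2.mul_le h'.le).add (h.1.le.mul_lt h'.2)
  convert this using 1; ring
lemma JEq.C (ω : σ → ℚ) (c : k) : JEq ω 0 (C c : MvPolynomial σ k) := by
  classical
  intro d hd
  rw [coeff_C] at hd
  have : 0 = d := by by_contra h; simp [h] at hd
  subst this; simp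
lemma JEq.refl_lead {ω : σ → ℚ} {a : ℚ} {f : MvPolynomial σ k} (h : JEq ω a f) :
    JLead ω a f f := ⟨h, by intro d; simp⟩
lemma JEq.X (ω : σ → ℚ) (i : σ) : JEq ω (ω i) (X i : MvPolynomial σ k) := by
  classical
  intro d hd
  rw [coeff_X] at hd
  have : Finsupp.single i 1 = d := by by_contra h; simp [h] at hd
  subst this; simp [Finsupp.weight_single]
lemma JLead.pow {ω : σ → ℚ} {a : ℚ} {f g : MvPolynomial σ k} (h : JLead ω a f g) (n : ℕ) :
    JLead ω (n * a) (f ^ n) (g ^ n) := by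
  induction n with
  | zero => simpa using (JEq.C ω (1 : k)).refl_lead
  | succ n ih =>
    rw [pow_succ, pow_succ]
    convert ih.mul h using 1
    push_cast; ring
lemma JLead.prod {ω : σ → ℚ} {ι : Type*} (s : Finset ι) {a : ι → ℚ} {f g : ι → MvPolynomial σ k}
    (h : ∀ i ∈ s, JLead ω (a i) (f i) (g i)) :
    JLead ω (∑ i ∈ s, a i) (∏ i ∈ s, f i) (∏ i ∈ s, g i) := by
  classical
  induction s using Finset.induction_on with
  | empty => simpa using (JEq.C ω (1 : k)).refl_lead
  | insert i s hi ih =>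
    rw [Finset.sum_insert hi, Finset.prod_insert hi, Finset.prod_insert hi]
    exact (h i (by simp)).mul (ih fun j hj => h j (by simp [hj]))
lemma JLead.unique {ω : σ → ℚ} {a : ℚ} {f g g' : MvPolynomial σ k} (h : JLead ω a f g)
    (h' : JLead ω a f g') : g = g' := by
  ext d
  by_contra hne
  by_cases hw : Finsupp.weight ω d = a
  · have h1 : coeff d (f - g) = 0 := by
      by_contra hh; exact (h.2 d hh).ne hw
    have h2 : coeff d (f - g') = 0 := by
      by_contra hh; exact (h'.2 d hh).ne hw
    rw [coeff_sub] at h1 h2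
    exact hne (by linear_combination h2 - h1)
  · have h1 : coeff d g = 0 := by by_contra hh; exact hw (h.1 d hh)
    have h2 : coeff d g' = 0 := by by_contra hh; exact hw (h'.1 d hh)
    exact hne (h1.trans h2.symm)
lemma JLead.monomial {ω : σ → ℚ} {α : τ → ℚ} {F G : τ → MvPolynomial σ k}
    (h : ∀ i, JLead ω (α i) (F i) (G i)) (d : τ →₀ ℕ) (c : k) :
    JLead ω (Finsupp.weight α d) (aeval F (monomial d c)) (aeval G (monomial d c)) := by
  rw [aeval_monomial, aeval_monomial, Finsupp.weight_apply, Finsupp.prod, Finsupp.prod, Finsupp.sum]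
  have := (JEq.C ω c).refl_lead.mul (JLead.prod d.support (fun i _ => (h i).pow (d i)))
  simpa using this
lemma JLead.comp {ω : σ → ℚ} {α : τ → ℚ} {F G : τ → MvPolynomial σ k}
    (h : ∀ i, JLead ω (α i) (F i) (G i)) {w : ℚ} {u H : MvPolynomial τ k} (hu : JLead α w u H) :
    JLead ω w (aeval F u) (aeval G H) := by
  constructor
  · rw [H.as_sum, map_sum]
    refine JEq.sum _ _ fun d hd => ?_
    rw [← hu.1 d (by simpa using hd)]
    exact (JLead.monomial h d _).1
  · have e : aeval F u - aeval G H = aeval F (u - H) + (aeval F H - aeval G H) := by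
      rw [map_sub]; ring
    rw [e]
    refine JLt.add ?_ ?_
    · have hl := hu.2
      generalize u - H = v at hl ⊢
      rw [v.as_sum, map_sum]
      refine JLt.sum _ _ fun d hd => ?_
      have h1 := hl d (by simpa using hd)
      intro p hp
      exact ((JLead.monomial h d _).le p hp).trans_lt h1
    · rw [H.as_sum, map_sum, map_sum, ← Finset.sum_sub_distrib]
      refine JLt.sum _ _ fun d hd => ?_
      rw [← hu.1 d (by simpa using hd)]
      exact (JLead.monomial h d _).2
/-- existence -/
lemma JLead.exists_of_le {ω : σ → ℚ} {a : ℚ} {f : MvPolynomial σ k} (h : JLe ω a f) :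
    JLead ω a f (weightedHomogeneousComponent ω a f) := by
  classical
  constructor
  · intro d hd
    rw [coeff_weightedHomogeneousComponent] at hd
    by_contra hh; simp [hh] at hd
  · intro d hd
    rw [coeff_sub, coeff_weightedHomogeneousComponent] at hd
    by_cases hh : Finsupp.weight ω d = a
    · simp [hh] at hd
    · simp only [hh, if_false, sub_zero] at hd
      exact lt_of_le_of_ne (h d hd) hh
end partB

section partC
variable {k : Type*} [Field k]

lemma jvk_weight_cons (c : ℚ) (α : Fin 2 → ℚ) (q : ℕ) (m : Fin 2 →₀ ℕ) :
    Finsupp.weight (Fin.cons c α : Fin 3 → ℚ) (m.cons q) = q * c + Finsupp.weight α m := by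
  rw [Finsupp.weight_apply, Finsupp.weight_apply, Finsupp.sum_fintype _ _ (by simp),
    Finsupp.sum_fintype _ _ (by simp), Fin.sum_univ_succ]
  simp

lemma jvk_aeval_C (H : MvPolynomial (Fin 2) k) :
    aeval (fun i => (Polynomial.C (X i) : Polynomial (MvPolynomial (Fin 2) k))) H
      = Polynomial.C H := by
  have : (aeval (fun i => (Polynomial.C (X i) : Polynomial (MvPolynomial (Fin 2) k)))) =
      (Polynomial.CAlgHom : MvPolynomial (Fin 2) k →ₐ[MvPolynomial (Fin 2) k] _).restrictScalars k := by
    apply MvPolynomial.algHom_ext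
    intro i; simp
  rw [this]; rfl

lemma jvk_graded (u : MvPolynomial (Fin 2) k)
    (μ : MvPolynomial (Fin 2) k →ₐ[k] Polynomial (MvPolynomial (Fin 2) k))
    (h0 : ∀ f, (μ f).coeff 0 = f) (hne : ∃ f, μ f ≠ Polynomial.C f)
    (hu : μ u = Polynomial.C u) (α : Fin 2 → ℚ) (w : ℚ) (H : MvPolynomial (Fin 2) k)
    (hL : JLead α w u H) :
    ∃ P : Fin 2 → Polynomial (MvPolynomial (Fin 2) k), (∀ i, (P i).coeff 0 = X i) ∧
      (∃ i, (P i).natDegree ≠ 0) ∧ aeval P H = Polynomial.C H := by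
  classical
  set E := finSuccEquiv k 2 with hE
  set F : Fin 2 → MvPolynomial (Fin 3) k := fun i => E.symm (μ (X i)) with hF
  have hco : ∀ i q m, coeff (m.cons q) (F i) = coeff m ((μ (X i)).coeff q) := by
    intro i q m
    rw [← finSuccEquiv_coeff_coeff]; simp [hF, hE]
  have hμ : ∀ f, μ f = aeval (fun i => μ (X i)) f := by
    intro f
    conv_lhs => rw [← aeval_X_left_apply f]
    rw [← comp_aeval_apply]
  let S : Finset (Σ _ : Fin 2, Fin 3 →₀ ℕ) :=
    Finset.univ.sigma fun i => (F i).support.filter fun d => d 0 ≠ 0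
  let v : (Σ _ : Fin 2, Fin 3 →₀ ℕ) → ℚ := fun p => (Finsupp.weight α p.2.tail - α p.1) / (p.2 0)
  have hS : S.Nonempty := by
    by_contra hS
    rw [Finset.not_nonempty_iff_eq_empty] at hS
    obtain ⟨f, hf⟩ := hne
    apply hf
    rw [hμ, ← jvk_aeval_C]
    congr 2
    ext1 i
    ext q m
    rcases Nat.eq_zero_or_pos q with rfl | hq
    · rw [h0]; simp
    · rw [Polynomial.coeff_C_of_ne_zero hq.ne', ← hco, coeff_zero]
      by_contra hc
      have : (⟨i, m.cons q⟩ : Σ _ : Fin 2, Fin 3 →₀ ℕ) ∈ S := by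
        simp [S, hc]; omega
      simp [hS] at this
  obtain ⟨⟨i₀, d₀⟩, hd₀, hmax⟩ := Finset.exists_max_image S v hS
  set c := v ⟨i₀, d₀⟩ with hc
  let ω : Fin 3 → ℚ := Fin.cons (-c) α
  have hω : ∀ d : Fin 3 →₀ ℕ, Finsupp.weight ω d = (d 0) * (-c) + Finsupp.weight α d.tail := by
    intro d
    conv_lhs => rw [← Finsupp.cons_tail d]
    exact jvk_weight_cons _ _ _ _
  have hle : ∀ i, JLe ω (α i) (F i) := by
    intro i d hd
    rw [hω]
    by_cases hq : d 0 = 0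
    · have : coeff d.tail (X i : MvPolynomial (Fin 2) k) ≠ 0 := by
        rw [← h0 (X i), ← hco, ← hq, Finsupp.cons_tail]; exact hd
      rw [JEq.X α i _ this]; simp [hq]
    · have hm := hmax ⟨i, d⟩ (by simp [S, hq]; simpa using hd)
      have hpos : (0 : ℚ) < d 0 := by positivity
      have : (Finsupp.weight α d.tail - α i) / (d 0) ≤ c := hm
      rw [div_le_iff₀ hpos] at this
      linarith
  let G : Fin 2 → MvPolynomial (Fin 3) k := fun i => weightedHomogeneousComponent ω (α i) (F i)
  have hFG : ∀ i, JLead ω (α i) (F i) (G i) := fun i => JLead.exists_of_le (hle i)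
  have h1 := JLead.comp hFG hL
  have hsucc : ∀ i : Fin 2, JLead ω (α i) (X i.succ : MvPolynomial (Fin 3) k) (X i.succ) := by
    intro i
    exact (JEq.X ω i.succ).refl_lead
  have h2 := JLead.comp hsucc hL
  have hEs : ∀ f : MvPolynomial (Fin 2) k, E (aeval (fun i : Fin 2 => (X i.succ : MvPolynomial (Fin 3) k)) f)
      = Polynomial.C f := by
    intro f
    rw [← jvk_aeval_C, ← AlgEquiv.coe_toAlgHom, comp_aeval_apply]
    congr 2; ext1 i; simp [hE, finSuccEquiv_X_succ]
  have hEF : E (aeval F u) = Polynomial.C u := by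
    rw [← AlgEquiv.coe_toAlgHom, comp_aeval_apply, ← hu, hμ]
    congr 2; ext1 i; simp [hF]
  have he : aeval F u = aeval (fun i : Fin 2 => (X i.succ : MvPolynomial (Fin 3) k)) u :=
    E.injective (by rw [hEF, hEs])
  rw [he] at h1
  have h3 := h1.unique h2
  refine ⟨fun i => E (G i), ?_, ⟨i₀, ?_⟩, ?_⟩
  · intro i
    ext m
    rw [finSuccEquiv_coeff_coeff, coeff_weightedHomogeneousComponent, hco, h0]
    by_cases hm : coeff m (X i : MvPolynomial (Fin 2) k) = 0
    · simp [hm]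
    · rw [if_pos]
      rw [jvk_weight_cons, JEq.X α i _ hm]; simp
  · intro hdeg
    have hd := hd₀
    simp only [S, Finset.mem_sigma, Finset.mem_univ, true_and, Finset.mem_filter] at hd
    have hpos : (0 : ℚ) < d₀ 0 := by have := hd.2; positivity
    have hz : coeff d₀ (G i₀) = 0 := by
      conv_lhs => rw [← Finsupp.cons_tail d₀]
      rw [← finSuccEquiv_coeff_coeff, Polynomial.coeff_eq_zero_of_natDegree_lt, coeff_zero]
      rw [hdeg]; omega
    simp only [G] at hz
    rw [coeff_weightedHomogeneousComponent, if_pos] at hz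
    · exact (mem_support_iff.mp hd.1) hz
    · rw [hω]
      have : (Finsupp.weight α d₀.tail - α i₀) / (d₀ 0) = c := rfl
      rw [div_eq_iff hpos.ne'] at this
      linarith
  · have := congrArg E h3
    rw [hEs, ← AlgEquiv.coe_toAlgHom, comp_aeval_apply] at this
    exact this
end partC

section partD
variable {k : Type*} [Field k]

/-- homogenization of `q` at `S, T` in degree `t` -/
noncomputable def jL {A : Type*} [CommRing A] [Algebra k A] (t : ℕ) (S T : A) (q : Polynomial k) : A :=
  ∑ n ∈ Finset.range (t + 1), algebraMap k A (q.coeff n) * S ^ n * T ^ (t - n)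

lemma jL_zero {A : Type*} [CommRing A] [Algebra k A] (t : ℕ) (S T : A) :
    jL t S T (0 : Polynomial k) = 0 := by simp [jL]
lemma jL_add {A : Type*} [CommRing A] [Algebra k A] (t : ℕ) (S T : A) (p q : Polynomial k) :
    jL t S T (p + q) = jL t S T p + jL t S T q := by
  simp [jL, add_mul, Finset.sum_add_distrib]
lemma jL_C_mul {A : Type*} [CommRing A] [Algebra k A] (t : ℕ) (S T : A) (c : k) (q : Polynomial k) :
    jL t S T (Polynomial.C c * q) = algebraMap k A c * jL t S T q := by
  simp [jL, Finset.mul_sum, mul_assoc]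
lemma jL_sum {A : Type*} [CommRing A] [Algebra k A] (t : ℕ) (S T : A) {ι : Type*} (s : Finset ι)
    (p : ι → Polynomial k) :
    jL t S T (∑ i ∈ s, p i) = ∑ i ∈ s, jL t S T (p i) := by
  classical
  induction s using Finset.induction_on with
  | empty => simp [jL_zero]
  | insert i s hi ih => rw [Finset.sum_insert hi, Finset.sum_insert hi, jL_add, ih]
lemma jL_monomial {A : Type*} [CommRing A] [Algebra k A] (t : ℕ) (S T : A) (n : ℕ) (hn : n ≤ t)
    (c : k) :
    jL t S T (Polynomial.monomial n c) = algebraMap k A c * S ^ n * T ^ (t - n) := by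
  rw [jL, Finset.sum_eq_single n]
  · simp
  · intro m _ hm; simp [Polynomial.coeff_monomial, hm.symm]
  · intro h; simp at h; omega
lemma jL_X_mul {A : Type*} [CommRing A] [Algebra k A] (t : ℕ) (S T : A) (q : Polynomial k) :
    jL (t + 1) S T (Polynomial.X * q) = S * jL t S T q := by
  rw [jL, Finset.sum_range_succ', jL, Finset.mul_sum]
  simp only [Polynomial.coeff_X_mul, Polynomial.mul_coeff_zero, Polynomial.coeff_X_zero, zero_mul,
    map_zero, add_zero]
  refine Finset.sum_congr rfl fun n _ => ?_
  rw [Nat.add_sub_add_right]; ring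
lemma jL_succ {A : Type*} [CommRing A] [Algebra k A] (t : ℕ) (S T : A) (q : Polynomial k)
    (hq : q.natDegree ≤ t) :
    jL (t + 1) S T q = T * jL t S T q := by
  rw [jL, Finset.sum_range_succ, jL, Finset.mul_sum,
    Polynomial.coeff_eq_zero_of_natDegree_lt (by omega : q.natDegree < t + 1)]
  simp only [map_zero, zero_mul, add_zero]
  refine Finset.sum_congr rfl fun n hn => ?_
  simp at hn
  rw [show t + 1 - n = (t - n) + 1 by omega]; ring
lemma jL_prod {A : Type*} [CommRing A] [Algebra k A] (S T : A) (s : Multiset k) (m : ℕ) :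
    jL (Multiset.card s + m) S T (s.map fun ρ => Polynomial.X - Polynomial.C ρ).prod =
      T ^ m * (s.map fun ρ => S - algebraMap k A ρ * T).prod := by
  induction s using Multiset.induction_on with
  | empty =>
    have := jL_monomial (Multiset.card (0 : Multiset k) + m) S T 0 (Nat.zero_le _) (1 : k)
    simpa using this
  | cons ρ s ih =>
    have hd : (s.map fun ρ => Polynomial.X - Polynomial.C ρ).prod.natDegree ≤ Multiset.card s + m := by
      rw [Polynomial.natDegree_multiset_prod_X_sub_C_eq_card]; omega
    rw [Multiset.map_cons, Multiset.prod_cons, Multiset.map_cons, Multiset.prod_cons,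
      Multiset.card_cons, show Multiset.card s + 1 + m = (Multiset.card s + m) + 1 by omega,
      sub_eq_add_neg, add_mul, jL_add, jL_X_mul, ← Polynomial.C_neg, jL_C_mul, jL_succ _ _ _ _ hd, ih,
      map_neg]
    ring

lemma jvk_monomial_two {i j : Fin 2} (hij : i ≠ j) (d : Fin 2 →₀ ℕ) (c : k) :
    monomial d c = C c * X i ^ d i * X j ^ d j := by
  rw [monomial_eq, Finsupp.prod_fintype _ _ (by simp), Fin.prod_univ_two]
  fin_cases i <;> fin_cases j <;> simp at hij ⊢ <;> ring

lemma jvk_arith {α β x y x' y' : ℕ} (hα : 0 < α) (hβ : 0 < β) (hc : Nat.Coprime α β)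
    (h : α * x + β * y = α * x' + β * y') :
    x % β = x' % β ∧ y % α = y' % α ∧ x / β + y / α = x' / β + y' / α := by
  have h1 : x % β = x' % β := by
    have : α * x ≡ α * x' [MOD β] := by
      have h2 : α * x + β * y ≡ α * x' + β * y' [MOD β] := by rw [h]
      simpa [Nat.ModEq] using h2
    exact Nat.ModEq.cancel_left_of_coprime hc.symm this
  have h2 : y % α = y' % α := by
    have : β * y ≡ β * y' [MOD α] := by
      have h2 : α * x + β * y ≡ α * x' + β * y' [MOD α] := by rw [h]
      simpa [Nat.ModEq] using h2
    exact Nat.ModEq.cancel_left_of_coprime hc this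
  refine ⟨h1, h2, ?_⟩
  have e1 := Nat.div_add_mod x β
  have e2 := Nat.div_add_mod x' β
  have e3 := Nat.div_add_mod y α
  have e4 := Nat.div_add_mod y' α
  rw [h1] at e1
  rw [h2] at e3
  generalize x / β = q1 at *
  generalize x' / β = q2 at *
  generalize y / α = q3 at *
  generalize y' / α = q4 at *
  generalize x' % β = r1 at *
  generalize y' % α = r2 at *
  subst e1 e2 e3 e4
  have : 0 < α * β := by positivity
  apply Nat.eq_of_mul_eq_mul_left this
  nlinarith

lemma jvk_factor [IsAlgClosed k] {i j : Fin 2} (hij : i ≠ j) (α β w : ℕ) (hα : 0 < α) (hβ : 0 < β)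
    (hc : Nat.Coprime α β)
    (H : MvPolynomial (Fin 2) k) (hH : H ≠ 0) (hom : ∀ d, coeff d H ≠ 0 → α * d i + β * d j = w) :
    ∃ (c : k) (m n : ℕ) (s : Multiset k), c ≠ 0 ∧ m < β ∧
      H = C c * X i ^ m * X j ^ n * (s.map fun ρ => X i ^ β - C ρ * X j ^ α).prod := by
  obtain ⟨d', hd'⟩ := ne_zero_iff.mp hH
  have key : ∀ d, coeff d H ≠ 0 → d i % β = d' i % β ∧ d j % α = d' j % α ∧
      d i / β + d j / α = d' i / β + d' j / α := fun d hd =>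
    jvk_arith hα hβ hc ((hom d hd).trans (hom d' hd').symm)
  set t := d' i / β + d' j / α
  let q : Polynomial k := ∑ d ∈ H.support, Polynomial.monomial (d i / β) (coeff d H)
  have hHq : H = X i ^ (d' i % β) * X j ^ (d' j % α) *
      jL t (X i ^ β) (X j ^ α) q := by
    simp only [q]
    rw [jL_sum, Finset.mul_sum]
    conv_lhs => rw [H.as_sum]
    refine Finset.sum_congr rfl fun d hd => ?_
    obtain ⟨k1, k2, k3⟩ := key d (by simpa using hd)
    rw [jL_monomial _ _ _ _ ((Nat.le_add_right _ _).trans k3.le), jvk_monomial_two hij,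
      show t - d i / β = d j / α by rw [← k3]; exact Nat.add_sub_cancel_left ..,
      ← k1, ← k2]
    conv_lhs => rw [← Nat.mod_add_div (d i) β, ← Nat.mod_add_div (d j) α]
    rw [← pow_mul, ← pow_mul, pow_add, pow_add, algebraMap_eq]
    ring
  have hq0 : q ≠ 0 := by
    intro h; rw [h, jL_zero, mul_zero] at hHq; exact hH hHq
  have hqd : q.natDegree ≤ t := by
    refine Polynomial.natDegree_sum_le_of_forall_le _ _ fun d hd => ?_
    obtain ⟨k1, k2, k3⟩ := key d (by simpa using hd)
    exact (Polynomial.natDegree_monomial_le _).trans ((Nat.le_add_right _ _).trans k3.le)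
  have hsp := (IsAlgClosed.splits q).eq_prod_roots
  have hcard : Multiset.card q.roots ≤ t := (Polynomial.card_roots' q).trans hqd
  refine ⟨q.leadingCoeff, d' i % β, d' j % α + α * (t - Multiset.card q.roots), q.roots,
    by simpa using hq0, Nat.mod_lt _ hβ, ?_⟩
  rw [hHq]
  conv_lhs => rw [hsp, jL_C_mul]
  have := jL_prod (X i ^ β : MvPolynomial (Fin 2) k) (X j ^ α) q.roots (t - Multiset.card q.roots)
  rw [show Multiset.card q.roots + (t - Multiset.card q.roots) = t by omega] at this
  rw [this, pow_add, pow_mul, algebraMap_eq]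
  ring

lemma jvk_coeff_zero {P : Fin 2 → Polynomial (MvPolynomial (Fin 2) k)}
    (hP0 : ∀ i, (P i).coeff 0 = X i) (F : MvPolynomial (Fin 2) k) : (aeval P F).coeff 0 = F := by
  induction F using MvPolynomial.induction_on with
  | C a =>
    rw [MvPolynomial.aeval_C, Polynomial.algebraMap_apply, Polynomial.coeff_C_zero]
    rfl
  | add p q hp hq => rw [map_add, Polynomial.coeff_add, hp, hq]
  | mul_X p i hp => rw [map_mul, Polynomial.mul_coeff_zero, hp, aeval_X, hP0]

lemma jvk_inv_dvd {P : Fin 2 → Polynomial (MvPolynomial (Fin 2) k)}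
    (hP0 : ∀ i, (P i).coeff 0 = X i) {F G : MvPolynomial (Fin 2) k} (hFG : F ∣ G) (hG : G ≠ 0)
    (hi : aeval P G = Polynomial.C G) : aeval P F = Polynomial.C F := by
  obtain ⟨K, rfl⟩ := hFG
  have h1 : (aeval P F * aeval P K).natDegree = 0 := by
    rw [← map_mul, hi, Polynomial.natDegree_C]
  have h2 : aeval P F * aeval P K ≠ 0 := by
    rw [← map_mul, hi]; simpa using hG
  rw [Polynomial.natDegree_mul (left_ne_zero_of_mul h2) (right_ne_zero_of_mul h2)] at h1
  rw [Polynomial.eq_C_of_natDegree_eq_zero (p := aeval P F) (by omega), jvk_coeff_zero hP0]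

lemma jvk_inv_absurd {P : Fin 2 → Polynomial (MvPolynomial (Fin 2) k)}
    (hPne : ∃ i, (P i).natDegree ≠ 0) {i j : Fin 2} (hij : i ≠ j)
    (hi : aeval P (X i : MvPolynomial (Fin 2) k) = Polynomial.C (X i))
    (hj : aeval P (X j : MvPolynomial (Fin 2) k) = Polynomial.C (X j)) : False := by
  obtain ⟨l, hl⟩ := hPne
  have : l = i ∨ l = j := by fin_cases i <;> fin_cases j <;> fin_cases l <;> simp at *
  rw [aeval_X] at hi hj
  rcases this with rfl | rfl
  · rw [hi] at hl; simp at hl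
  · rw [hj] at hl; simp at hl

lemma jvk_shape {P : Fin 2 → Polynomial (MvPolynomial (Fin 2) k)}
    (hP0 : ∀ i, (P i).coeff 0 = X i) (hPne : ∃ i, (P i).natDegree ≠ 0)
    {i j : Fin 2} (hij : i ≠ j) {e : ℕ} (he : 1 ≤ e) {c : k} {n : ℕ} {s : Multiset k}
    {H : MvPolynomial (Fin 2) k} (hH0 : H ≠ 0) (hHC : ∀ a, H ≠ C a) (hc : c ≠ 0)
    (hi : aeval P H = Polynomial.C H)
    (hH : H = C c * X j ^ n * (s.map fun ρ => X i - C ρ * X j ^ e).prod) :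
    ∃ i j : Fin 2, i ≠ j ∧ ∃ (γ c : k) (e N : ℕ), c ≠ 0 ∧ 1 ≤ e ∧ 1 ≤ N ∧
      H = C c * (X i - C γ * X j ^ e) ^ N := by
  rcases Multiset.empty_or_exists_mem s with rfl | ⟨ρ, hρ⟩
  · refine ⟨j, i, hij.symm, 0, c, 1, n, hc, le_rfl, ?_, by simp [hH]⟩
    by_contra hn
    have : n = 0 := by omega
    subst this
    exact hHC c (by simp [hH])
  · have hdv : ∀ ρ ∈ s, (X i - C ρ * X j ^ e : MvPolynomial (Fin 2) k) ∣ H := by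
      intro ρ hρ
      rw [hH]
      exact Dvd.dvd.mul_left (Multiset.dvd_prod (Multiset.mem_map_of_mem _ hρ)) _
    have h1 := jvk_inv_dvd hP0 (hdv ρ hρ) hH0 hi
    have habs : aeval P (X j : MvPolynomial (Fin 2) k) = Polynomial.C (X j) → False := by
      intro hj
      refine jvk_inv_absurd hPne hij ?_ hj
      have h2 : (X i : MvPolynomial (Fin 2) k) = (X i - C ρ * X j ^ e) + C ρ * X j ^ e := by ring
      have h3 : aeval P (C ρ : MvPolynomial (Fin 2) k) = Polynomial.C (C ρ) := by
        rw [MvPolynomial.aeval_C, Polynomial.algebraMap_apply]; rfl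
      rw [h2, map_add, h1, map_mul, map_pow, hj, h3]
      simp
    have hn : n = 0 := by
      by_contra hn
      apply habs
      refine jvk_inv_dvd hP0 ?_ hH0 hi
      rw [hH]
      exact Dvd.dvd.mul_right (Dvd.dvd.mul_left (dvd_pow_self _ hn) _) _
    have hs : ∀ ρ' ∈ s, ρ' = ρ := by
      intro ρ' hρ'
      by_contra hne
      apply habs
      have h2 := jvk_inv_dvd hP0 (hdv ρ' hρ') hH0 hi
      have h3 : aeval P (C (ρ' - ρ) * X j ^ e : MvPolynomial (Fin 2) k) =
          Polynomial.C (C (ρ' - ρ) * X j ^ e) := by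
        have : (C (ρ' - ρ) * X j ^ e : MvPolynomial (Fin 2) k) =
          (X i - C ρ * X j ^ e) - (X i - C ρ' * X j ^ e) := by rw [C_sub]; ring
        rw [this, map_sub, h1, h2, ← map_sub]
      refine jvk_inv_dvd hP0 ?_ ?_ h3
      · exact Dvd.dvd.mul_left (dvd_pow_self _ (by omega)) _
      · refine mul_ne_zero ?_ (pow_ne_zero _ (X_ne_zero _))
        rw [Ne, C_eq_zero]
        exact sub_ne_zero.mpr hne
    have hs' := Multiset.eq_replicate_card.mpr hs
    refine ⟨i, j, hij, ρ, c, e, Multiset.card s, hc, he, Multiset.card_pos_iff_exists_mem.mpr ⟨ρ, hρ⟩, ?_⟩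
    rw [hH, hn, hs']
    simp

lemma jvk_key_closed [IsAlgClosed k] {P : Fin 2 → Polynomial (MvPolynomial (Fin 2) k)}
    (hP0 : ∀ i, (P i).coeff 0 = X i) (hPne : ∃ i, (P i).natDegree ≠ 0)
    {H : MvPolynomial (Fin 2) k} (hH0 : H ≠ 0) (hHC : ∀ a, H ≠ C a)
    (hi : aeval P H = Polynomial.C H) (a b w : ℕ) (ha : 0 < a) (hb : 0 < b)
    (hom : ∀ d, coeff d H ≠ 0 → a * d 0 + b * d 1 = w) :
    ∃ i j : Fin 2, i ≠ j ∧ ∃ (γ c : k) (e N : ℕ), c ≠ 0 ∧ 1 ≤ e ∧ 1 ≤ N ∧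
      H = C c * (X i - C γ * X j ^ e) ^ N := by
  obtain ⟨g, α, β, hg, hcop, rfl, rfl⟩ := Nat.exists_coprime' (m := a) (n := b) (Nat.gcd_pos_of_pos_left _ ha)
  have hα : 0 < α := Nat.pos_of_mul_pos_right ha
  have hβ : 0 < β := Nat.pos_of_mul_pos_right hb
  have hom' : ∀ d, coeff d H ≠ 0 → α * d 0 + β * d 1 = w / g := by
    intro d hd
    rw [← hom d hd, show α * g * d 0 + β * g * d 1 = g * (α * d 0 + β * d 1) by ring,
      Nat.mul_div_cancel_left _ hg]
  obtain ⟨c, m, n, s, hc, hm, hH⟩ := jvk_factor (i := 0) (j := 1) (by simp) α β (w / g) hα hβ hcop H hH0 hom'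
  by_cases hβ1 : β = 1
  · subst hβ1
    have : m = 0 := by omega
    subst this
    refine jvk_shape hP0 hPne (i := 0) (j := 1) (by simp) hα hH0 hHC hc hi (n := n) (s := s) ?_
    simpa using hH
  by_cases hα1 : α = 1
  · subst hα1
    obtain ⟨c, m, n, s, hc, hm, hH⟩ := jvk_factor (i := 1) (j := 0) (by simp) β 1 (w / g) hβ hα
      hcop.symm H hH0 (fun d hd => by rw [← hom' d hd]; ring)
    have : m = 0 := by omega
    subst this
    refine jvk_shape hP0 hPne (i := 1) (j := 0) (by simp) hβ hH0 hHC hc hi (n := n) (s := s) ?_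
    simpa using hH
  have hs : ∀ ρ ∈ s, ρ = 0 := by
    intro ρ hρ
    by_contra hne
    have hdv : (X 0 ^ β - C ρ * X 1 ^ α : MvPolynomial (Fin 2) k) ∣ H := by
      rw [hH]
      exact Dvd.dvd.mul_left (Multiset.dvd_prod (Multiset.mem_map_of_mem
        (fun ρ => (X 0 ^ β - C ρ * X 1 ^ α : MvPolynomial (Fin 2) k)) hρ)) _
    have h1 := jvk_inv_dvd hP0 hdv hH0 hi
    have h2 := jvk_binom P β α (by omega) (by omega) hcop.symm ρ hne (by
      have h3 : aeval P (C ρ : MvPolynomial (Fin 2) k) = Polynomial.C (C ρ) := by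
        rw [MvPolynomial.aeval_C, Polynomial.algebraMap_apply]; rfl
      have h4 : algebraMap k (Polynomial (MvPolynomial (Fin 2) k)) ρ = Polynomial.C (C ρ) := by
        rw [Polynomial.algebraMap_apply]; rfl
      rw [map_sub, map_mul, map_pow, map_pow, h3] at h1
      simpa [h4] using h1)
    obtain ⟨i, hi⟩ := hPne
    fin_cases i
    · exact hi h2.1
    · exact hi h2.2
  have hs' := Multiset.eq_replicate_card.mpr hs
  generalize Multiset.card s = N at hs'
  subst hs'
  have hH' : H = C c * X 0 ^ (m + β * N) * X 1 ^ n := by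
    rw [hH]; simp; ring
  generalize m + β * N = m' at hH'
  rcases Nat.eq_zero_or_pos m' with rfl | hm'
  · refine jvk_shape hP0 hPne (i := 0) (j := 1) (by simp) le_rfl hH0 hHC hc hi (n := n) (s := 0) ?_
    simpa using hH'
  rcases Nat.eq_zero_or_pos n with rfl | hn
  · refine jvk_shape hP0 hPne (i := 1) (j := 0) (by simp) le_rfl hH0 hHC hc hi (n := m') (s := 0) ?_
    simpa using hH'
  exfalso
  refine jvk_inv_absurd hPne (i := 0) (j := 1) (by simp) (jvk_inv_dvd hP0 ?_ hH0 hi)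
    (jvk_inv_dvd hP0 ?_ hH0 hi)
  · rw [hH']
    exact Dvd.dvd.mul_right (Dvd.dvd.mul_left (dvd_pow_self _ (by omega)) _) _
  · rw [hH']
    exact Dvd.dvd.mul_left (dvd_pow_self _ (by omega)) _

lemma jvk_coeff_single {i j : Fin 2} (hij : i ≠ j) (N : ℕ) (F : MvPolynomial (Fin 2) k) :
    coeff (Finsupp.single i N) F =
      (aeval (fun l : Fin 2 => if l = i then (Polynomial.X : Polynomial k) else 0) F).coeff N := by
  classical
  induction F using MvPolynomial.induction_on' with
  | add p q hp hq => rw [map_add, Polynomial.coeff_add, coeff_add, hp, hq]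
  | monomial d a =>
    have h : aeval (fun l : Fin 2 => if l = i then (Polynomial.X : Polynomial k) else 0) (monomial d a)
      = Polynomial.C a * Polynomial.X ^ d i * 0 ^ d j := by
      rw [jvk_monomial_two hij]
      simp [hij.symm]
    rw [h, coeff_monomial]
    have h2 : d = Finsupp.single i N ↔ d i = N ∧ d j = 0 := by
      constructor
      · rintro rfl; simp [hij]
      · rintro ⟨h1, h2⟩
        ext l
        have : l = i ∨ l = j := by fin_cases i <;> fin_cases j <;> fin_cases l <;> simp at *
        rcases this with rfl | rfl
        · simp [h1]
        · simp [h2, hij]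
    simp only [h2]
    by_cases hj : d j = 0
    · simp [hj, Polynomial.coeff_X_pow, eq_comm]
    · simp [hj]

lemma jvk_coeff_shape {i j : Fin 2} (hij : i ≠ j) {e : ℕ} (he : 1 ≤ e) (γ : k) (N : ℕ) :
    coeff (Finsupp.single i N) ((X i - C γ * X j ^ e) ^ N : MvPolynomial (Fin 2) k) = 1 := by
  rw [jvk_coeff_single hij]
  simp [hij.symm, show e ≠ 0 by omega]

lemma jvk_key {P : Fin 2 → Polynomial (MvPolynomial (Fin 2) k)}
    (hP0 : ∀ i, (P i).coeff 0 = X i) (hPne : ∃ i, (P i).natDegree ≠ 0)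
    {H : MvPolynomial (Fin 2) k} (hH0 : H ≠ 0) (hHC : ∀ a, H ≠ C a)
    (hi : aeval P H = Polynomial.C H) (a b w : ℕ) (ha : 0 < a) (hb : 0 < b)
    (hom : ∀ d, coeff d H ≠ 0 → a * d 0 + b * d 1 = w) :
    ∃ i j : Fin 2, i ≠ j ∧ ∃ (γ c : k) (e N : ℕ), c ≠ 0 ∧ 1 ≤ e ∧ 1 ≤ N ∧
      H = C c * (X i - C γ * X j ^ e) ^ N := by
  let L := AlgebraicClosure k
  let f : k →+* L := algebraMap k L
  have hf : Function.Injective f := f.injective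
  let M : MvPolynomial (Fin 2) k →+* MvPolynomial (Fin 2) L := MvPolynomial.map f
  have hM : Function.Injective M := MvPolynomial.map_injective f hf
  let P' : Fin 2 → Polynomial (MvPolynomial (Fin 2) L) := fun i => (P i).map M
  have hP0' : ∀ i, (P' i).coeff 0 = X i := by
    intro i; simp [P', hP0, M]
  have hPne' : ∃ i, (P' i).natDegree ≠ 0 := by
    obtain ⟨i, hi⟩ := hPne
    exact ⟨i, by simpa [P', Polynomial.natDegree_map_eq_of_injective hM] using hi⟩
  have hae : ∀ F, aeval P' (M F) = (aeval P F).map M := by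
    intro F
    induction F using MvPolynomial.induction_on with
    | C a =>
      simp [M, Polynomial.algebraMap_apply, MvPolynomial.algebraMap_eq]
    | add p q hp hq => rw [map_add, map_add, map_add, Polynomial.map_add, hp, hq]
    | mul_X p i hp =>
      rw [map_mul, map_mul, map_mul, Polynomial.map_mul, hp, aeval_X]
      simp [M, P']
  have hH0' : M H ≠ 0 := by rwa [Ne, map_eq_zero_iff M hM]
  have hi' : aeval P' (M H) = Polynomial.C (M H) := by rw [hae, hi, Polynomial.map_C]
  have hHC' : ∀ a, M H ≠ C a := by
    intro a ha
    apply hHC (coeff 0 H)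
    apply hM
    rw [ha]
    have : coeff 0 (M H) = a := by rw [ha, coeff_C]; simp
    rw [coeff_map] at this
    rw [← this]; simp [M]
  obtain ⟨i, j, hij, γ, c, e, N, hc, he, hN, hH⟩ := jvk_key_closed hP0' hPne' hH0' hHC' hi' a b w ha hb
    (fun d hd => hom d (by
      intro h0; apply hd; rw [coeff_map, h0, map_zero]))
  -- descend `γ`
  have hγ : ∃ γ₀ : k, f γ₀ = γ := by
    have hdv : (X i - C γ * X j ^ e : MvPolynomial (Fin 2) L) ∣ M H := by
      rw [hH]; exact Dvd.dvd.mul_left (dvd_pow_self _ (by omega)) _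
    have h1 := jvk_inv_dvd hP0' hdv hH0' hi'
    have h3 : aeval P' (C γ : MvPolynomial (Fin 2) L) = Polynomial.C (C γ) := by
      rw [MvPolynomial.aeval_C, Polynomial.algebraMap_apply]; rfl
    rw [map_sub, map_mul, map_pow, h3, aeval_X, aeval_X] at h1
    have h2 : (P j ^ e).natDegree ≠ 0 := by
      intro h0
      have hj0 : (P j).natDegree = 0 := by
        rw [Polynomial.natDegree_pow] at h0
        rcases Nat.mul_eq_zero.mp h0 with h | h
        · omega
        · exact h
      have hj0' : (P' j).natDegree = 0 := by
        simpa [P', Polynomial.natDegree_map_eq_of_injective hM] using hj0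
      have hjC := Polynomial.eq_C_of_natDegree_eq_zero hj0'
      rw [hP0'] at hjC
      have hiC : P' i = Polynomial.C (X i) := by
        rw [hjC, sub_eq_iff_eq_add] at h1
        rw [h1]; simp
      exact jvk_inv_absurd hPne' hij (by rw [aeval_X, hiC]) (by rw [aeval_X, hjC])
    set q := (P j ^ e).natDegree
    have hq : (P j ^ e).coeff q ≠ 0 := by
      intro h
      have := Polynomial.leadingCoeff_eq_zero.mp h
      apply h2; show (P j ^ e).natDegree = 0; rw [this]; simp
    obtain ⟨m, hm⟩ := ne_zero_iff.mp hq
    have h4 := congrArg (fun r => coeff m (Polynomial.coeff r q)) h1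
    simp only [P', ← Polynomial.map_pow, Polynomial.coeff_sub, Polynomial.coeff_C_mul, coeff_sub,
      coeff_C_mul, Polynomial.coeff_map, M, coeff_map, Polynomial.coeff_C_of_ne_zero h2, coeff_zero] at h4
    refine ⟨coeff m ((P i).coeff q) / coeff m ((P j ^ e).coeff q), ?_⟩
    rw [map_div₀, div_eq_iff (by simpa using hm)]
    linear_combination h4
  obtain ⟨γ₀, rfl⟩ := hγ
  have hc' : ∃ c₀ : k, f c₀ = c := by
    refine ⟨coeff (Finsupp.single i N) H, ?_⟩
    have h1 := congrArg (coeff (Finsupp.single i N)) hH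
    rw [coeff_map] at h1
    rw [h1, coeff_C_mul]
    rw [jvk_coeff_shape hij he, mul_one]
  obtain ⟨c₀, rfl⟩ := hc'
  refine ⟨i, j, hij, γ₀, c₀, e, N, by rintro rfl; simp at hc, he, hN, ?_⟩
  apply hM
  rw [hH]
  simp [M]
end partD

section partE
variable {k : Type*} [Field k]

/-- `u` is invariant under some nontrivial coaction-like map. -/
def JQ (u : MvPolynomial (Fin 2) k) : Prop :=
  ∃ μ : MvPolynomial (Fin 2) k →ₐ[k] Polynomial (MvPolynomial (Fin 2) k),
    (∀ f, (μ f).coeff 0 = f) ∧ (∃ f, μ f ≠ Polynomial.C f) ∧ μ u = Polynomial.C u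

lemma JQ_X0 : JQ (X 0 : MvPolynomial (Fin 2) k) := by
  refine ⟨aeval (fun i => Polynomial.C (X i) + if i = 0 then 0 else Polynomial.X), ?_, ⟨X 1, ?_⟩, ?_⟩
  · intro f
    apply jvk_coeff_zero
    intro i
    by_cases h : i = 0 <;> simp [h]
  · rw [aeval_X]
    intro h
    have := congrArg (fun p => Polynomial.coeff p 1) h
    simp at this
  · simp

lemma JQ.map {u : MvPolynomial (Fin 2) k} (h : JQ u)
    (ψ : MvPolynomial (Fin 2) k ≃ₐ[k] MvPolynomial (Fin 2) k) : JQ (ψ u) := by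
  obtain ⟨μ, h1, ⟨f, hf⟩, h3⟩ := h
  have hv : ∀ g, ((Polynomial.mapAlgHom (ψ : MvPolynomial (Fin 2) k →ₐ[k] MvPolynomial (Fin 2) k)).comp
    (μ.comp (ψ.symm : MvPolynomial (Fin 2) k →ₐ[k] MvPolynomial (Fin 2) k))) g =
      (μ (ψ.symm g)).map (ψ : MvPolynomial (Fin 2) k →+* MvPolynomial (Fin 2) k) := fun g => rfl
  refine ⟨(Polynomial.mapAlgHom (ψ : MvPolynomial (Fin 2) k →ₐ[k] MvPolynomial (Fin 2) k)).comp
      (μ.comp (ψ.symm : MvPolynomial (Fin 2) k →ₐ[k] MvPolynomial (Fin 2) k)), ?_, ⟨ψ f, ?_⟩, ?_⟩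
  · intro g
    rw [hv, Polynomial.coeff_map, h1]; simp
  · rw [hv]
    intro hh
    apply hf
    apply Polynomial.map_injective (ψ : MvPolynomial (Fin 2) k →+* MvPolynomial (Fin 2) k) ψ.injective
    simpa using hh
  · rw [hv]; simp [h3]

/-- elementary automorphism -/
noncomputable def jElem {i j : Fin 2} (hij : i ≠ j) (f : Polynomial k) :
    MvPolynomial (Fin 2) k ≃ₐ[k] MvPolynomial (Fin 2) k :=
  AlgEquiv.ofAlgHom
    (aeval fun l => if l = i then X i + Polynomial.aeval (X j) f else X l)
    (aeval fun l => if l = i then X i - Polynomial.aeval (X j) f else X l)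
    (by
      apply MvPolynomial.algHom_ext
      intro l
      by_cases h : l = i
      · subst h; simp [← Polynomial.aeval_algHom_apply, hij.symm]
      · simp [h])
    (by
      apply MvPolynomial.algHom_ext
      intro l
      by_cases h : l = i
      · subst h; simp [← Polynomial.aeval_algHom_apply, hij.symm]
      · simp [h])

lemma jElem_apply {i j : Fin 2} (hij : i ≠ j) (f : Polynomial k) (u : MvPolynomial (Fin 2) k) :
    jElem hij f u = aeval (fun l => if l = i then X i + Polynomial.aeval (X j) f else X l) u := rfl

/-- swap -/
noncomputable def jSwap : MvPolynomial (Fin 2) k ≃ₐ[k] MvPolynomial (Fin 2) k :=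
  renameEquiv k (Equiv.swap 0 1)

lemma jSwap_X0 : (jSwap (X 0) : MvPolynomial (Fin 2) k) = X 1 := by simp [jSwap]
lemma jSwap_X1 : (jSwap (X 1) : MvPolynomial (Fin 2) k) = X 0 := by simp [jSwap]

/-- the tame group -/
noncomputable def jT (k : Type*) [Field k] : Subgroup (MvPolynomial (Fin 2) k ≃ₐ[k] MvPolynomial (Fin 2) k) :=
  Subgroup.closure {ψ | IsAffineAut ψ ∨ IsTriangularAut ψ}

lemma jSwap_mem : jSwap ∈ jT k := by
  apply Subgroup.subset_closure
  left
  intro i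
  fin_cases i
  · show totalDegree (jSwap (X 0) : MvPolynomial (Fin 2) k) ≤ 1
    rw [jSwap_X0, totalDegree_X]
  · show totalDegree (jSwap (X 1) : MvPolynomial (Fin 2) k) ≤ 1
    rw [jSwap_X1, totalDegree_X]

lemma jvk_equiv_ext {φ ψ : MvPolynomial (Fin 2) k ≃ₐ[k] MvPolynomial (Fin 2) k}
    (h0 : φ (X 0) = ψ (X 0)) (h1 : φ (X 1) = ψ (X 1)) : φ = ψ := by
  have : (φ : MvPolynomial (Fin 2) k →ₐ[k] MvPolynomial (Fin 2) k) = ψ := by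
    apply MvPolynomial.algHom_ext
    intro i
    fin_cases i
    · exact h0
    · exact h1
  ext1 x
  exact DFunLike.congr_fun this x

lemma jElem_mem {i j : Fin 2} (hij : i ≠ j) (f : Polynomial k) : jElem hij f ∈ jT k := by
  have h01 : jElem (by simp : (0 : Fin 2) ≠ 1) f ∈ jT k := by
    apply Subgroup.subset_closure
    right
    refine ⟨1, 1, 0, f, one_ne_zero, one_ne_zero, ?_, ?_⟩
    · simp [jElem_apply]
    · simp [jElem_apply]
  have : (i = 0 ∧ j = 1) ∨ (i = 1 ∧ j = 0) := by fin_cases i <;> fin_cases j <;> simp at *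
  rcases this with ⟨rfl, rfl⟩ | ⟨rfl, rfl⟩
  · exact h01
  · have : jElem hij f = jSwap * jElem (by simp : (0 : Fin 2) ≠ 1) f * jSwap := by
      apply jvk_equiv_ext
      · simp [AlgEquiv.mul_apply, jSwap_X0, jSwap_X1, jElem_apply]
      · rw [AlgEquiv.mul_apply, AlgEquiv.mul_apply, jSwap_X1]
        rw [jElem_apply, jElem_apply, aeval_X, aeval_X, if_pos rfl, if_pos rfl, map_add, jSwap_X0,
          ← Polynomial.aeval_algHom_apply, jSwap_X1]
    rw [this]
    exact mul_mem (mul_mem jSwap_mem h01) jSwap_mem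

lemma jvk_exists_degreeOf {u : MvPolynomial (Fin 2) k} {i : Fin 2} (h : 0 < degreeOf i u) :
    ∃ d, coeff d u ≠ 0 ∧ d i = degreeOf i u := by
  by_contra! hh
  have : degreeOf i u < degreeOf i u := by
    rw [degreeOf_lt_iff h]
    intro d hd
    exact lt_of_le_of_ne (degreeOf_le_iff.mp le_rfl d hd) (hh d (by simpa using hd))
  omega

lemma jvk_step {u : MvPolynomial (Fin 2) k} (hQ : JQ u) (h0 : 0 < degreeOf 0 u) (h1 : 0 < degreeOf 1 u) :
    ∃ ψ ∈ jT k, degreeOf 0 (ψ u) + degreeOf 1 (ψ u) < degreeOf 0 u + degreeOf 1 u := by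
  classical
  let a : Fin 2 → ℕ := ![degreeOf 1 u, degreeOf 0 u]
  let α : Fin 2 → ℚ := fun l => (a l : ℚ)
  have hα : ∀ d, Finsupp.weight α d = ((a 0 * d 0 + a 1 * d 1 : ℕ) : ℚ) := by
    intro d
    rw [Finsupp.weight_apply, Finsupp.sum_fintype _ _ (by simp), Fin.sum_univ_two]
    simp [α]; ring
  have hsupp : u.support.Nonempty := by
    obtain ⟨d, hd, _⟩ := jvk_exists_degreeOf h0
    exact ⟨d, by simpa using hd⟩
  obtain ⟨d₀, hd₀, hmax⟩ := Finset.exists_max_image u.support (fun d => a 0 * d 0 + a 1 * d 1) hsupp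
  set w : ℕ := a 0 * d₀ 0 + a 1 * d₀ 1 with hw
  have hle : ∀ d, coeff d u ≠ 0 → a 0 * d 0 + a 1 * d 1 ≤ w := fun d hd => hmax d (by simpa using hd)
  have hwge : a 0 * a 1 ≤ w := by
    obtain ⟨d, hd, hd'⟩ := jvk_exists_degreeOf h0
    have := hle d hd
    have e : a 1 = degreeOf 0 u := rfl
    rw [e, ← hd']; omega
  have ha0 : 0 < a 0 := h1
  have ha1 : 0 < a 1 := h0
  have hwpos : 0 < w := lt_of_lt_of_le (Nat.mul_pos ha0 ha1) hwge
  have hJle : JLe α (w : ℚ) u := by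
    intro d hd
    rw [hα]; exact_mod_cast hle d hd
  set H := weightedHomogeneousComponent α (w : ℚ) u
  have hL : JLead α (w : ℚ) u H := JLead.exists_of_le hJle
  have hHco : ∀ d, coeff d H = if a 0 * d 0 + a 1 * d 1 = w then coeff d u else 0 := by
    intro d
    rw [coeff_weightedHomogeneousComponent, hα]
    simp only [Nat.cast_inj]
  have hom : ∀ d, coeff d H ≠ 0 → a 0 * d 0 + a 1 * d 1 = w := by
    intro d hd
    rw [hHco] at hd
    by_contra h; simp [h] at hd
  have hH0 : H ≠ 0 := by
    intro h
    have := hHco d₀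
    rw [h, if_pos hw.symm, coeff_zero] at this
    simp at hd₀
    exact hd₀ this.symm
  have hHC : ∀ b, H ≠ C b := by
    intro b hb
    have hb0 : b ≠ 0 := by rintro rfl; simp at hb; exact hH0 hb
    have := hom 0 (by rw [hb]; simpa using hb0)
    simp at this; omega
  obtain ⟨μ, q1, q2, q3⟩ := hQ
  obtain ⟨P, p1, p2, p3⟩ := jvk_graded u μ q1 q2 q3 α w H hL
  obtain ⟨i, j, hij, γ, c, e, N, hc, he, hN, hH⟩ := jvk_key p1 p2 hH0 hHC p3 (a 0) (a 1) w ha0 ha1 hom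
  have hij' : (i = 0 ∧ j = 1) ∨ (i = 1 ∧ j = 0) := by fin_cases i <;> fin_cases j <;> simp at *
  have hai : a i = degreeOf j u := by rcases hij' with ⟨rfl, rfl⟩ | ⟨rfl, rfl⟩ <;> rfl
  have haj : a j = degreeOf i u := by rcases hij' with ⟨rfl, rfl⟩ | ⟨rfl, rfl⟩ <;> rfl
  have hsum : ∀ d : Fin 2 →₀ ℕ, a 0 * d 0 + a 1 * d 1 = a i * d i + a j * d j := by
    intro d; rcases hij' with ⟨rfl, rfl⟩ | ⟨rfl, rfl⟩ <;> ring
  have haipos : 0 < a i := by rcases hij' with ⟨rfl, rfl⟩ | ⟨rfl, rfl⟩ <;> assumption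
  have hajpos : 0 < a j := by rcases hij' with ⟨rfl, rfl⟩ | ⟨rfl, rfl⟩ <;> assumption
  have hwge' : a i * a j ≤ w := by
    rcases hij' with ⟨rfl, rfl⟩ | ⟨rfl, rfl⟩
    · exact hwge
    · rwa [mul_comm]
  -- the monomial `X i ^ N`
  have hNH : coeff (Finsupp.single i N) H ≠ 0 := by
    rw [hH, coeff_C_mul, jvk_coeff_shape hij he, mul_one]; exact hc
  have hNw : a i * N = w := by
    have := hom _ hNH
    rw [hsum] at this
    simpa [hij] using this
  have hNle : N ≤ a j := by
    rw [haj]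
    have : coeff (Finsupp.single i N) u ≠ 0 := by
      intro h; rw [hHco, h] at hNH; simp at hNH
    have := degreeOf_le_iff.mp (le_refl (degreeOf i u)) _ (mem_support_iff.mpr this)
    simpa using this
  have hNeq : N = a j := by
    apply le_antisymm hNle
    rw [← hNw] at hwge'
    exact Nat.le_of_mul_le_mul_left hwge' haipos
  -- the monomial `X j ^ (a i)`
  have hea : e * a j = a i := by
    obtain ⟨d, hd, hd'⟩ := jvk_exists_degreeOf (i := j) (u := u) (by omega)
    have hdw := hle d hd
    rw [hsum, hd', ← hai, ← hNw, hNeq] at hdw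
    have hdi : d i = 0 := by
      have : a i * d i = 0 := by rw [mul_comm (a j)] at hdw; omega
      rcases Nat.mul_eq_zero.mp this with h | h
      · omega
      · exact h
    have hds : d = Finsupp.single j (a i) := by
      ext l
      have : l = i ∨ l = j := by rcases hij' with ⟨rfl, rfl⟩ | ⟨rfl, rfl⟩ <;> fin_cases l <;> simp
      rcases this with rfl | rfl
      · simp [hdi, hij]
      · simp [hd', hai]
    have hdH : coeff d H ≠ 0 := by
      rw [hHco, if_pos]
      · exact hd
      · rw [hsum, hdi, hd', ← hai, ← hNw, hNeq]; ring
    rw [hds, hH, coeff_C_mul, jvk_coeff_single hij.symm] at hdH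
    have hN0 : N ≠ 0 := by omega
    have hev : aeval (fun l : Fin 2 => if l = j then (Polynomial.X : Polynomial k) else 0)
        ((X i - C γ * X j ^ e) ^ N : MvPolynomial (Fin 2) k) =
        Polynomial.C ((-γ) ^ N) * Polynomial.X ^ (e * N) := by
      simp [hij]
      rw [← neg_mul, mul_pow, ← pow_mul]
    rw [hev, Polynomial.coeff_C_mul_X_pow] at hdH
    by_contra hne
    rw [if_neg (by rw [hNeq]; exact Ne.symm hne)] at hdH
    simp at hdH
  have hαe : (e : ℚ) * α j = α i := by simp only [α]; exact_mod_cast hea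
  refine ⟨jElem hij (Polynomial.C γ * Polynomial.X ^ e), jElem_mem _ _, ?_⟩
  set v := jElem hij (Polynomial.C γ * Polynomial.X ^ e) u with hv
  have hlead : JLead α (w : ℚ) v (C c * X i ^ N) := by
    have hFF : ∀ l, JLead α (α l)
        ((fun l => if l = i then X i + Polynomial.aeval (X j) (Polynomial.C γ * Polynomial.X ^ e)
          else X l : Fin 2 → MvPolynomial (Fin 2) k) l)
        ((fun l => if l = i then X i + Polynomial.aeval (X j) (Polynomial.C γ * Polynomial.X ^ e)
          else X l : Fin 2 → MvPolynomial (Fin 2) k) l) := by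
      intro l
      apply JEq.refl_lead
      by_cases hl : l = i
      · subst hl
        simp only [if_true]
        refine (JEq.X α l).add ?_
        have := (JEq.C α γ).mul ((JEq.X (k := k) α j).refl_lead.pow e).1
        rw [hαe, zero_add] at this
        simpa [MvPolynomial.algebraMap_eq] using this
      · simp only [if_neg hl]
        exact JEq.X α l
    have := JLead.comp hFF hL
    rw [hH] at this
    have hev : aeval (fun l => if l = i then
        X i + Polynomial.aeval (X j) (Polynomial.C γ * Polynomial.X ^ e) else X l)
        (C c * (X i - C γ * X j ^ e) ^ N : MvPolynomial (Fin 2) k) = C c * X i ^ N := by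
      simp only [map_mul, map_pow, map_sub, aeval_X, if_true, if_neg hij.symm,
        MvPolynomial.aeval_C, Polynomial.aeval_C, Polynomial.aeval_X, MvPolynomial.algebraMap_eq,
        add_sub_cancel_right]
    rw [hev] at this
    exact this
  have hlead' : ∀ d, coeff d v ≠ 0 → a i * d i + a j * d j ≤ w ∧ (d j = 0 ∨ a i * d i + a j * d j < w) := by
    intro d hd
    have e1 := hlead.le d hd
    rw [hα, hsum] at e1
    refine ⟨by exact_mod_cast e1, ?_⟩
    by_cases hdd : d = Finsupp.single i N
    · left; rw [hdd]; simp [hij]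
    · right
      have e2 := hlead.2 d (by
        rw [coeff_sub, coeff_C_mul, coeff_X_pow, if_neg (Ne.symm hdd)]; simpa using hd)
      rw [hα, hsum] at e2
      exact_mod_cast e2
  have r1 : degreeOf i v ≤ degreeOf i u := by
    rw [degreeOf_le_iff]
    intro d hd
    have := (hlead' d (by simpa using hd)).1
    rw [← haj, ← hNeq]
    rw [← hNw] at this
    exact Nat.le_of_mul_le_mul_left (by omega) haipos
  have r2 : degreeOf j v < degreeOf j u := by
    rw [degreeOf_lt_iff (by omega)]
    intro d hd
    rw [← hai]
    rcases (hlead' d (by simpa using hd)).2 with h | h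
    · omega
    · rw [← hNw, hNeq, mul_comm (a i) (a j)] at h
      exact Nat.lt_of_mul_lt_mul_left (a := a j) (by omega)
  rcases hij' with ⟨rfl, rfl⟩ | ⟨rfl, rfl⟩ <;> omega

lemma jvk_main (n : ℕ) : ∀ u : MvPolynomial (Fin 2) k, JQ u → degreeOf 0 u + degreeOf 1 u ≤ n →
    ∃ ψ ∈ jT k, degreeOf 1 (ψ u) = 0 := by
  induction n with
  | zero =>
    intro u _ h
    exact ⟨1, one_mem _, by simp; omega⟩
  | succ n ih =>
    intro u hQ h
    by_cases h1 : degreeOf 1 u = 0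
    · exact ⟨1, one_mem _, by simpa using h1⟩
    by_cases h0 : degreeOf 0 u = 0
    · refine ⟨jSwap, jSwap_mem, ?_⟩
      have := degreeOf_rename_of_injective (p := u) (Equiv.swap (0 : Fin 2) 1).injective 0
      simp at this
      rw [← h0, ← this]
      rfl
    obtain ⟨ψ, hψ, hlt⟩ := jvk_step hQ (by omega) (by omega)
    obtain ⟨ψ', hψ', hd⟩ := ih (ψ u) (hQ.map ψ) (by omega)
    exact ⟨ψ' * ψ, mul_mem hψ' hψ, by simpa using hd⟩
end partE

section partF
variable {k : Type*} [Field k]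

lemma jvk_final (θ : MvPolynomial (Fin 2) k ≃ₐ[k] MvPolynomial (Fin 2) k)
    (hθ : degreeOf 0 (θ (X 1)) = 0) : IsTriangularAut θ := by
  let E : MvPolynomial (Fin 2) k ≃ₐ[k] Polynomial (Polynomial k) :=
    (finSuccEquiv k 1).trans (Polynomial.mapAlgEquiv (uniqueAlgEquiv k (Fin 1)))
  have hE0 : E (X 0) = Polynomial.X := by
    simp [E, finSuccEquiv_X_zero]
  have hE1 : E (X 1) = Polynomial.C Polynomial.X := by
    have : (1 : Fin 2) = Fin.succ 0 := rfl
    simp only [E, AlgEquiv.trans_apply]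
    rw [this, finSuccEquiv_X_succ]
    simp
  have hEd : ∀ f, (E f).natDegree = degreeOf 0 f := by
    intro f
    rw [← natDegree_finSuccEquiv]
    exact Polynomial.natDegree_map_eq_of_injective (uniqueAlgEquiv k (Fin 1)).injective _
  have hEp : ∀ f : Polynomial k, E (Polynomial.aeval (X 1) f) = Polynomial.C f := by
    intro f
    rw [← Polynomial.aeval_algHom_apply, hE1]
    induction f using Polynomial.induction_on' with
    | add p q hp hq => rw [map_add, hp, hq, map_add]
    | monomial n a =>
      rw [Polynomial.aeval_monomial, ← Polynomial.C_mul_X_pow_eq_monomial]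
      simp [Polynomial.algebraMap_apply]
  set p := (E (θ (X 1))).coeff 0 with hp
  have hpC : E (θ (X 1)) = Polynomial.C p :=
    Polynomial.eq_C_of_natDegree_eq_zero (by rw [hEd, hθ])
  set V := E (θ (X 0)) with hV
  let Θ := (E.symm.trans θ).trans E
  let h : Polynomial k →ₐ[k] Polynomial k := Polynomial.aeval p
  have hΘC : ∀ a, Θ (Polynomial.C a) = Polynomial.C (h a) := by
    intro a
    have e1 : Θ (Polynomial.C a) = E (θ (Polynomial.aeval (X 1) a)) := by
      simp only [Θ, AlgEquiv.trans_apply]; rw [← hEp, AlgEquiv.symm_apply_apply]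
    rw [e1, ← Polynomial.aeval_algHom_apply, ← Polynomial.aeval_algHom_apply, hpC]
    exact Polynomial.aeval_algebraMap_apply (Polynomial (Polynomial k)) p a
  have hΘX : Θ Polynomial.X = V := by
    simp only [Θ, AlgEquiv.trans_apply]; rw [← hE0, AlgEquiv.symm_apply_apply]
  have hΘ : ∀ R, Θ R = (R.map (h : Polynomial k →+* Polynomial k)).comp V := by
    intro R
    induction R using Polynomial.induction_on' with
    | add p q hp hq => rw [map_add, hp, hq, Polynomial.map_add, Polynomial.add_comp]
    | monomial n a =>
      rw [← Polynomial.C_mul_X_pow_eq_monomial, map_mul, map_pow, hΘC, hΘX]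
      simp
  obtain ⟨R, hR⟩ := Θ.surjective Polynomial.X
  rw [hΘ] at hR
  have hd1 := congrArg Polynomial.natDegree hR
  rw [Polynomial.natDegree_comp, Polynomial.natDegree_X] at hd1
  have hRd := Nat.eq_one_of_mul_eq_one_right hd1
  have hVd := Nat.eq_one_of_mul_eq_one_left hd1
  have hlc := congrArg Polynomial.leadingCoeff hR
  rw [Polynomial.leadingCoeff_comp (by omega), Polynomial.leadingCoeff_X, hRd, pow_one] at hlc
  have hunit : IsUnit V.leadingCoeff := IsUnit.of_mul_eq_one_right _ hlc
  obtain ⟨c, hc, hcV⟩ := Polynomial.isUnit_iff.mp hunit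
  obtain ⟨S, hS⟩ := Θ.surjective (Polynomial.C Polynomial.X)
  rw [hΘ] at hS
  have hd2 := congrArg Polynomial.natDegree hS
  rw [Polynomial.natDegree_comp, Polynomial.natDegree_C, hVd, mul_one] at hd2
  rw [Polynomial.eq_C_of_natDegree_eq_zero hd2, Polynomial.C_comp, Polynomial.C_inj,
    Polynomial.coeff_map] at hS
  have hS' : (S.coeff 0).comp p = Polynomial.X := hS
  have hd3 := congrArg Polynomial.natDegree hS'
  rw [Polynomial.natDegree_comp, Polynomial.natDegree_X] at hd3
  have hpd := Nat.eq_one_of_mul_eq_one_left hd3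
  have hpe := Polynomial.eq_X_add_C_of_natDegree_le_one hpd.le
  have hVe := Polynomial.eq_X_add_C_of_natDegree_le_one hVd.le
  have hV1 : V.coeff 1 = Polynomial.C c := by
    rw [hcV, Polynomial.leadingCoeff, hVd]
  have hECc : ∀ a : k, E (C a) = Polynomial.C (Polynomial.C a) := by
    intro a
    have := E.commutes a
    rw [MvPolynomial.algebraMap_eq] at this
    rw [this, Polynomial.algebraMap_apply]; rfl
  refine ⟨c, p.coeff 1, p.coeff 0, V.coeff 0, hc.ne_zero, ?_, ?_, ?_⟩
  · intro h0
    rw [← hpd] at h0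
    have := Polynomial.leadingCoeff_eq_zero.mp h0
    rw [this] at hpd; simp at hpd
  · apply E.injective
    rw [map_add, map_mul, hEp, hECc, hE0, ← hV, ← hV1]
    exact hVe
  · apply E.injective
    rw [map_add, map_mul, hECc, hECc, hE1, hpC, ← Polynomial.C_mul, ← Polynomial.C_add]
    exact congrArg _ hpe

end partF

/-- Jung–van der Kulk: every `k`-algebra automorphism of `k[x,y]` is tame,
i.e. lies in the subgroup generated by affine and triangular automorphisms. -/
theorem jung_van_der_kulk (k : Type*) [Field k]
    (φ : MvPolynomial (Fin 2) k ≃ₐ[k] MvPolynomial (Fin 2) k) :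
    φ ∈ Subgroup.closure {ψ : MvPolynomial (Fin 2) k ≃ₐ[k] MvPolynomial (Fin 2) k |
      IsAffineAut ψ ∨ IsTriangularAut ψ} := by
  change φ ∈ jT k
  obtain ⟨ψ, hψ, hd⟩ := jvk_main _ (φ (X 0)) (JQ_X0.map φ) le_rfl
  have hθ : IsTriangularAut (jSwap * (ψ * φ) * jSwap) := by
    apply jvk_final
    simp only [AlgEquiv.mul_apply, jSwap_X1]
    have := degreeOf_rename_of_injective (p := ψ (φ (X 0))) (Equiv.swap (0 : Fin 2) 1).injective 1
    simp at this
    rw [← hd, ← this]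
    rfl
  have hm : jSwap * (ψ * φ) * jSwap ∈ jT k := Subgroup.subset_closure (Or.inr hθ)
  have h1 := (Subgroup.mul_mem_cancel_right _ jSwap_mem).mp hm
  have h2 := (Subgroup.mul_mem_cancel_left _ jSwap_mem).mp h1
  exact (Subgroup.mul_mem_cancel_left _ hψ).mp h2
end
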